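/- Consider gradient descent θ_{k+1} = θ_k − η∇f(θ_k) on the square-loss deep linear training loss f, starting from a balanced initial point θ_0 ∈ ℝ^d whose end-to-end matrix W_{n:1,0} satisfies ‖W_{n:1,0}‖_F ∈ (0, 0.2], and assume ν := Tr(Λ_yxᵀ W_{n:1,0})/(‖Λ_yx‖_F·‖W_{n:1,0}‖_F) ≠ −1. For any ε̃ > 0, if the step size satisfies η ≤ ( ‖W_{n:1,0}‖_F⁵ · min{1, ε̃} ) / ( n^{17/2} · e^{7n+6} · (max{1, (1−ν)/(1+ν)})^{(11n−5)/2} ) · ( ln( 15n·max{1, (1−ν)/(1+ν)} / (‖W_{n:1,0}‖_F·min{1, ε̃}) ) )^{−2}, then f(θ_k) − min_{q∈ℝ^d} f(q) ≤ ε̃, where k = ⌊ (2n·(max{1, (3/2)·(1−ν)/(1+ν)})^n / (‖W_{n:1,0}‖_F·η)) · ln( 15n·max{1, (1−ν)/(1+ν)} / (‖W_{n:1,0}‖_F·min{1, ε̃}) ) + 1 ⌋. -/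

import Mathlib

open scoped RealInnerProductSpace
open Matrix

noncomputable section

/-- The family of weight matrices of a depth-`n` fully connected network with layer widths
`dims 0, dims 1, …, dims n`: `W j` maps `ℝ^{dims j}` to `ℝ^{dims (j+1)}` (zero-indexed). -/
abbrev WeightFam (n : ℕ) (dims : ℕ → ℕ) : Type :=
  ∀ j : Fin n, Matrix (Fin (dims (j.val + 1))) (Fin (dims j.val)) ℝ

/-- Rectangular matrix with ones on the diagonal: equals the identity matrix whenever the
two dimensions coincide. -/
def castId (p q : ℕ) : Matrix (Fin p) (Fin q) ℝ :=
  Matrix.of fun i j => if (i : ℕ) = (j : ℕ) then 1 else 0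

/-- `segProd dims W a b = W_{b-1} * ⋯ * W_a` (zero-indexed), the identity when `a = b`.
This realizes the paper's product `W_{b : a+1}` (one-indexed), empty products being
identity matrices. -/
def segProd {n : ℕ} (dims : ℕ → ℕ) (W : WeightFam n dims) (a : ℕ) :
    (b : ℕ) → Matrix (Fin (dims b)) (Fin (dims a)) ℝ
  | 0 => castId (dims 0) (dims a)
  | b + 1 =>
      if a = b + 1 then castId (dims (b + 1)) (dims a)
      else if hb : b < n then W ⟨b, hb⟩ * segProd dims W a b else 0

/-- Frobenius norm of a matrix. -/
def frobNorm {p q : ℕ} (M : Matrix (Fin p) (Fin q) ℝ) : ℝ :=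
  Real.sqrt (∑ i, ∑ j, M i j ^ 2)

/-- A weight setting is balanced when `W_{j+1}ᵀ W_{j+1} = W_j W_jᵀ` for all adjacent
pairs of layers. -/
def IsBalanced {n : ℕ} (dims : ℕ → ℕ) (W : WeightFam n dims) : Prop :=
  ∀ (j : ℕ) (hj : j + 1 < n),
    (W ⟨j + 1, hj⟩)ᵀ * W ⟨j + 1, hj⟩ =
      W ⟨j, Nat.lt_of_succ_lt hj⟩ * (W ⟨j, Nat.lt_of_succ_lt hj⟩)ᵀ

/-- The Hessian of `f` at `x`, regarded as a quadratic form, evaluated at `v`. -/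
def hessQ {E : Type*} [NormedAddCommGroup E] [InnerProductSpace ℝ E] [CompleteSpace E]
    (f : E → ℝ) (x v : E) : ℝ :=
  ⟪v, fderiv ℝ (gradient f) x v⟫

/-- The iterates of gradient descent with step size `η` started at `θ0`. -/
def gdIter {E : Type*} [NormedAddCommGroup E] [InnerProductSpace ℝ E] [CompleteSpace E]
    (f : E → ℝ) (η : ℝ) (θ0 : E) : ℕ → E
  | 0 => θ0
  | k + 1 => gdIter f η θ0 k - η • gradient f (gdIter f η θ0 k)

/-- One step of gradient descent in the coordinates `a`, `z = ⟪x, Λ⟫`, `X = ‖x‖²`, for the end-to-end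
vector `a ^ (m + 1) • x` and a unit target `Λ`. -/
structure ScalarStep (m : ℕ) (η a z X a' z' X' : ℝ) : Prop where
  a_eq : a' = a + η * a ^ m * (z - a ^ (m + 1) * X)
  z_eq : z' = z + η * a ^ (m + 1) * (1 - a ^ (m + 1) * z)
  X_eq : X' = X - 2 * η * a ^ (m + 1) * (a ^ (m + 1) * X - z) +
    η ^ 2 * (a ^ (m + 1)) ^ 2 * ((a ^ (m + 1)) ^ 2 * X - 2 * a ^ (m + 1) * z + 1)
  cs : z ^ 2 ≤ X

/-- Nondegenerate, nearly balanced states. -/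
structure NearBalanced (m : ℕ) (μ a z X : ℝ) : Prop where
  pos : 0 < a
  le_one : a ≤ 1
  low : μ ≤ a ^ (m + 2)
  bal_low : a ^ 2 ≤ X
  bal_high : X ≤ a ^ 2 + 1 / 100 * μ

namespace ScalarStep

variable {m : ℕ} {η μ a z X a' z' X' : ℝ}

lemma residual_nonneg (P : ℝ) (cs : z ^ 2 ≤ X) : 0 ≤ P ^ 2 * X - 2 * P * z + 1 := by
  nlinarith [mul_le_mul_of_nonneg_left cs (sq_nonneg P), sq_nonneg (P * z - 1)]

lemma pow_bounds (hb : NearBalanced m μ a z X) :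
    0 < a ^ m ∧ a ^ m ≤ 1 ∧ a ^ (m + 1) = a ^ m * a ∧ a ^ (m + 2) = a ^ m * a ^ 2 ∧
      a ^ (m + 2) ≤ a ^ 2 ∧ a ^ (m + 2) ≤ a ^ m ∧ a ^ (m + 2) ≤ a := by
  have h1 := pow_pos hb.pos m
  have h2 := pow_le_one₀ (n := m) hb.pos.le hb.le_one
  have h3 : a ^ (m + 2) = a ^ m * a ^ 2 := by ring
  have h4 : a ^ 2 ≤ a := by nlinarith [hb.pos, hb.le_one]
  have h5 : 0 < a ^ 2 := pow_pos hb.pos 2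
  refine ⟨h1, h2, by ring, h3, ?_, ?_, ?_⟩ <;> rw [h3] <;> nlinarith [hb.pos, hb.le_one]

lemma abs_z_le (hs : ScalarStep m η a z X a' z' X') (hb : NearBalanced m μ a z X) :
    |z| ≤ 101 / 100 * a := by
  obtain ⟨-, -, -, -, h, -, -⟩ := pow_bounds hb
  apply abs_le_of_sq_le_sq _ (by linarith [hb.pos])
  nlinarith [hs.cs, hb.bal_high, hb.low, sq_nonneg a]

lemma a_le_one (hs : ScalarStep m η a z X a' z' X') (hb : NearBalanced m μ a z X)
    (hη : 0 < η) (hηm : η * (m + 2) ≤ 1 / 100) : a' ≤ 1 := by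
  obtain ⟨h1, h2, h3, h4, h5, h6, h7⟩ := pow_bounds hb
  have hz := (abs_le.1 (abs_z_le hs hb))
  have hber : 1 + ((m + 2 : ℕ) : ℝ) * (a - 1) ≤ (1 + (a - 1)) ^ (m + 2) :=
    one_add_mul_le_pow (by linarith [hb.pos]) _
  push_cast at hber
  rw [show 1 + (a - 1) = a by ring] at hber
  have hy : z - a ^ (m + 1) * X ≤ 2 * (1 - a ^ (m + 2)) := by
    set y := Real.sqrt X
    have hX0 : 0 ≤ X := (sq_nonneg a).trans hb.bal_low
    have hyX : y ^ 2 = X := Real.sq_sqrt hX0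
    have hy0 : 0 ≤ y := Real.sqrt_nonneg X
    have hay : a ≤ y := Real.le_sqrt_of_sq_le hb.bal_low
    have hy2 : y ≤ 2 := by
      have : X ≤ 4 := by nlinarith [hb.bal_high, hb.low, hb.pos, hb.le_one]
      nlinarith
    have hzy : z ≤ y := Real.le_sqrt_of_sq_le hs.cs
    have hP : 0 ≤ a ^ (m + 1) := pow_nonneg hb.pos.le _
    have h8 : a ^ (m + 2) = a ^ (m + 1) * a := by ring
    have h9 : a ^ (m + 2) ≤ 1 := h7.trans hb.le_one
    calc z - a ^ (m + 1) * X ≤ y - a ^ (m + 1) * (y * a) := by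
          rw [← hyX]
          nlinarith [mul_le_mul_of_nonneg_left (mul_le_mul_of_nonneg_left hay hy0) hP]
      _ = y * (1 - a ^ (m + 2)) := by rw [h8]; ring
      _ ≤ 2 * (1 - a ^ (m + 2)) := by nlinarith
  rw [hs.a_eq]
  have hga : 0 ≤ 1 - a := by linarith [hb.le_one]
  have : η * a ^ m * (z - a ^ (m + 1) * X) ≤ η * (2 * ((m + 2) * (1 - a))) := by
    have e1 : z - a ^ (m + 1) * X ≤ 2 * ((m + 2) * (1 - a)) := by linarith
    have e2 : 0 ≤ 2 * ((m + 2) * (1 - a)) := by positivity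
    calc _ ≤ η * a ^ m * (2 * ((m + 2) * (1 - a))) := by gcongr
      _ ≤ η * 1 * (2 * ((m + 2) * (1 - a))) := by gcongr
      _ = _ := by ring
  nlinarith

/-- Expansion of the update of `a` around the balanced manifold. -/
lemma a_eq' (hs : ScalarStep m η a z X a' z' X') :
    a' = a + η * a ^ m * (z - a * a ^ (m + 2) - a * a ^ m * (X - a ^ 2)) := by
  rw [hs.a_eq]; ring

lemma le_a (hs : ScalarStep m η a z X a' z' X') (hb : NearBalanced m μ a z X)
    (hη : 0 < η) : a * (1 - 3 * η) ≤ a' := by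
  obtain ⟨h1, h2, h3, h4, h5, h6, h7⟩ := pow_bounds hb
  have hz := (abs_le.1 (abs_z_le hs hb))
  have hD : X - a ^ 2 ≤ 1 / 100 := by
    nlinarith [hb.bal_high, hb.low, hb.le_one]
  have hD0 : 0 ≤ X - a ^ 2 := by linarith [hb.bal_low]
  have e1 : a * a ^ (m + 2) ≤ a := by nlinarith [hb.pos, hb.le_one]
  have e2 : a * a ^ m * (X - a ^ 2) ≤ a * (1 / 100) := by
    have : a * a ^ m ≤ a := by nlinarith [hb.pos]
    have := hb.pos
    gcongr
  have e3 : -(3 * a) ≤ z - a * a ^ (m + 2) - a * a ^ m * (X - a ^ 2) := by linarith [hb.pos]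
  rw [hs.a_eq']
  have : -(η * (3 * a)) ≤ η * a ^ m * (z - a * a ^ (m + 2) - a * a ^ m * (X - a ^ 2)) := by
    calc -(η * (3 * a)) ≤ -(η * a ^ m * (3 * a)) := by
          have : η * a ^ m * (3 * a) ≤ η * 1 * (3 * a) := by
            have := hb.pos
            gcongr
          linarith
      _ = η * a ^ m * (-(3 * a)) := by ring
      _ ≤ _ := by gcongr
  linarith

lemma pow_le_pow_a (hs : ScalarStep m η a z X a' z' X') (hb : NearBalanced m μ a z X)
    (hη : 0 < η) (hηm : η * (m + 2) ≤ 1 / 100) :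
    (1 - 3 * (η * (m + 2))) * a ^ (m + 2) ≤ a' ^ (m + 2) := by
  have hη' : η ≤ 1 / 100 := by nlinarith [(Nat.cast_nonneg m : (0 : ℝ) ≤ m)]
  have hber : 1 + ((m + 2 : ℕ) : ℝ) * (-(3 * η)) ≤ (1 + -(3 * η)) ^ (m + 2) :=
    one_add_mul_le_pow (by linarith) _
  push_cast at hber
  calc _ ≤ (1 + -(3 * η)) ^ (m + 2) * a ^ (m + 2) := by
        have := pow_pos hb.pos (m + 2)
        gcongr
        linarith
    _ = (a * (1 - 3 * η)) ^ (m + 2) := by rw [← mul_pow]; ring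
    _ ≤ a' ^ (m + 2) := by
        have := hb.pos
        exact pow_le_pow_left₀ (mul_nonneg this.le (by linarith)) (hs.le_a hb hη) _

/-- The imbalance `X - a²` stays nonnegative and grows at second order in `η`. -/
lemma imbalance (hs : ScalarStep m η a z X a' z' X') (hb : NearBalanced m μ a z X)
    (hη : 0 < η) (hη' : η ≤ 1 / 100)
    (hR : (a ^ (m + 1)) ^ 2 * X - 2 * a ^ (m + 1) * z + 1 ≤ 36 / 25) :
    0 ≤ X' - a' ^ 2 ∧ X' - a' ^ 2 ≤ X - a ^ 2 + 36 / 25 * η ^ 2 := by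
  obtain ⟨h1, h2, h3, h4, h5, h6, h7⟩ := pow_bounds hb
  have hR0 := residual_nonneg (a ^ (m + 1)) hs.cs
  set P := a ^ (m + 1) with hP
  set R := P ^ 2 * X - 2 * P * z + 1 with hRdef
  have hD0 : 0 ≤ X - a ^ 2 := by linarith [hb.bal_low]
  have hB2 : (a ^ m) ^ 2 ≤ 1 := pow_le_one₀ h1.le h2
  have ha2 : a ^ 2 ≤ 1 := pow_le_one₀ hb.pos.le hb.le_one
  have key : X' - a' ^ 2 = X - a ^ 2 + η ^ 2 * (a ^ m) ^ 2 * (a ^ 2 * R - (P * X - z) ^ 2) := by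
    rw [hs.X_eq, hs.a_eq, ← hP, ← hRdef, h3]; ring
  have key2 : a ^ 2 * R - (P * X - z) ^ 2 = X - z ^ 2 - (X - a ^ 2) * R := by
    rw [hRdef]; ring
  constructor
  · rw [key, key2]
    have e1 : 0 ≤ η ^ 2 * (a ^ m) ^ 2 * (X - z ^ 2) :=
      mul_nonneg (by positivity) (by linarith [hs.cs])
    have e2 : η ^ 2 * (a ^ m) ^ 2 * R ≤ 1 := by
      calc η ^ 2 * (a ^ m) ^ 2 * R ≤ (1 / 100) ^ 2 * 1 * (36 / 25) := by gcongr
        _ ≤ 1 := by norm_num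
    nlinarith [mul_le_mul_of_nonneg_left e2 hD0]
  · rw [key]
    have : a ^ 2 * R - (P * X - z) ^ 2 ≤ 36 / 25 := by
      nlinarith [sq_nonneg (P * X - z)]
    have : η ^ 2 * (a ^ m) ^ 2 * (a ^ 2 * R - (P * X - z) ^ 2) ≤ η ^ 2 * (a ^ m) ^ 2 * (36 / 25) := by
      gcongr
    have : η ^ 2 * (a ^ m) ^ 2 * (36 / 25) ≤ η ^ 2 * 1 * (36 / 25) := by gcongr
    linarith

/-- The squared residual contracts. -/
lemma residual_le (hs : ScalarStep m η a z X a' z' X') (hb : NearBalanced m μ a z X)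
    (hη : 0 < η) (hηm : η * (m + 2) ≤ 1 / 100) :
    (a' ^ (m + 1)) ^ 2 * X' - 2 * a' ^ (m + 1) * z' + 1 ≤
      (1 - η * a ^ (m + 1) * a' ^ (m + 1)) ^ 2 *
        ((a ^ (m + 1)) ^ 2 * X - 2 * a ^ (m + 1) * z + 1) := by
  obtain ⟨h1, h2, h3, h4, h5, h6, h7⟩ := pow_bounds hb
  have hη' : η ≤ 1 / 100 := by nlinarith [(Nat.cast_nonneg m : (0 : ℝ) ≤ m)]
  have ha'0 : 0 < a' := lt_of_lt_of_le (mul_pos hb.pos (by linarith)) (hs.le_a hb hη)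
  have ha'1 := hs.a_le_one hb hη hηm
  have hX2 : X ≤ 2 := by nlinarith [hb.bal_high, hb.low, hb.pos, hb.le_one]
  have hX0 : 0 ≤ X := (sq_nonneg a).trans hb.bal_low
  set g := a ^ (m + 1) * X - z with hg
  have hstep : a' - a = -(η * a ^ m * g) := by rw [hs.a_eq, hg]; ring
  have hgeom : a' ^ (m + 1) - a ^ (m + 1) =
      (∑ i ∈ Finset.range (m + 1), a' ^ i * a ^ (m + 1 - 1 - i)) * (a' - a) :=
    (geom_sum₂_mul a' a (m + 1)).symm
  set S := ∑ i ∈ Finset.range (m + 1), a' ^ i * a ^ (m + 1 - 1 - i) with hS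
  have hS0 : 0 ≤ S := Finset.sum_nonneg fun i _ =>
    mul_nonneg (pow_nonneg ha'0.le _) (pow_nonneg hb.pos.le _)
  have hS1 : S ≤ m + 1 := by
    have : S ≤ ∑ i ∈ Finset.range (m + 1), (1 : ℝ) := Finset.sum_le_sum fun i _ =>
      mul_le_one₀ (pow_le_one₀ ha'0.le ha'1) (pow_nonneg hb.pos.le _)
        (pow_le_one₀ hb.pos.le hb.le_one)
    simpa using this
  set c := S * (η * a ^ m) with hc
  have hβ : a' ^ (m + 1) = a ^ (m + 1) - c * g := by rw [hc]; linear_combination hgeom + S * hstep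
  have hc0 : 0 ≤ c := by positivity
  have hc1 : c ≤ 1 / 100 := by
    calc c ≤ (m + 1) * (η * 1) := by rw [hc]; gcongr
      _ ≤ 1 / 100 := by nlinarith
  set P := a ^ (m + 1)
  set P' := a' ^ (m + 1) with hP'
  have hP1 : 0 ≤ P ∧ P ≤ 1 := ⟨pow_nonneg hb.pos.le _, pow_le_one₀ hb.pos.le hb.le_one⟩
  have hP'1 : 0 ≤ P' ∧ P' ≤ 1 := ⟨pow_nonneg ha'0.le _, pow_le_one₀ ha'0.le ha'1⟩
  have hγ : 1 / 2 ≤ 1 - η * P * P' := by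
    have : η * P * P' ≤ 1 / 100 * 1 * 1 := by
      obtain ⟨_, _⟩ := hP1
      obtain ⟨_, _⟩ := hP'1
      gcongr
    linarith
  have key : P' ^ 2 * X' - 2 * P' * z' + 1 = (1 - η * P * P') ^ 2 * (P ^ 2 * X - 2 * P * z + 1)
      + 2 * (1 - η * P * P') * ((P' - P) * g) + (P' - P) ^ 2 * X := by
    rw [hs.X_eq, hs.z_eq, hg]; ring
  rw [key, show P' - P = -(c * g) by rw [hβ]; ring]
  have hcX : c * X ≤ 2 * (1 - η * P * P') := by nlinarith
  have := mul_le_mul_of_nonneg_left hcX (mul_nonneg hc0 (sq_nonneg g))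
  nlinarith

end ScalarStep

namespace ScalarStep

variable {m : ℕ} {η μ a z X a' z' X' : ℝ}

/-- The cone `κ a ≤ z` is forward invariant. -/
lemma cone (hs : ScalarStep m η a z X a' z' X') (hb : NearBalanced m μ a z X)
    (hη : 0 < η) (hη' : η ≤ 1 / 100) {κ : ℝ} (hκ0 : 0 ≤ κ) (hκ : κ ≤ 9 / 10) (h : κ * a ≤ z) :
    κ * a' ≤ z' := by
  obtain ⟨h1, h2, h3, h4, h5, h6, h7⟩ := pow_bounds hb
  have hz := (abs_le.1 (abs_z_le hs hb)).2
  have hD0 : 0 ≤ X - a ^ 2 := by linarith [hb.bal_low]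
  have key : z' - κ * a' = (z - κ * a) * (1 - η * a ^ m * a ^ (m + 2)) + η * a ^ m * (a - κ * z)
      + η * a ^ m * (κ * (a * a ^ m) * (X - a ^ 2)) := by
    rw [hs.z_eq, hs.a_eq]; ring
  have e1 : η * a ^ m * a ^ (m + 2) ≤ 1 := by
    have := hb.le_one
    calc η * a ^ m * a ^ (m + 2) ≤ 1 / 100 * 1 * 1 := by
          gcongr
          · exact pow_nonneg hb.pos.le _
          · exact h7.trans this
      _ ≤ 1 := by norm_num
  have e2 : 0 ≤ (z - κ * a) * (1 - η * a ^ m * a ^ (m + 2)) :=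
    mul_nonneg (by linarith) (by linarith)
  have e3 : 0 ≤ η * a ^ m * (a - κ * z) := by
    apply mul_nonneg (by positivity)
    have := mul_le_mul_of_nonneg_left hz hκ0
    nlinarith [hb.pos]
  have e4 : 0 ≤ η * a ^ m * (κ * (a * a ^ m) * (X - a ^ 2)) := by
    have := hb.pos
    positivity
  linarith

lemma drift_le (hb : NearBalanced m μ a z X) (hμ : μ ≤ 19 / 100) :
    a * a ^ m * (X - a ^ 2) ≤ a * (1 / 500) := by
  obtain ⟨h1, h2, h3, h4, h5, h6, h7⟩ := pow_bounds hb
  have := hb.pos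
  have hD0 : 0 ≤ X - a ^ 2 := by linarith [hb.bal_low]
  calc a * a ^ m * (X - a ^ 2) ≤ a * 1 * (1 / 500) := by
        gcongr
        linarith [hb.bal_high]
    _ = _ := by ring

/-- Inside the cone `κ a ≤ z`, levels of `a ^ (m + 2)` below `κ` are never crossed downwards. -/
lemma level_le (hs : ScalarStep m η a z X a' z' X') (hb : NearBalanced m μ a z X)
    (hη : 0 < η) (hηm : η * (m + 2) ≤ 1 / 1000) (hμ : μ ≤ 19 / 100) {κ ℓ : ℝ}
    (h : κ * a ≤ z) (hℓ : ℓ ≤ a ^ (m + 2))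
    (hκ : 1 / 200 ≤ κ) (hℓκ : ℓ ≤ (1 - 3 / 1000) * (κ - 1 / 200)) : ℓ ≤ a' ^ (m + 2) := by
  obtain ⟨h1, h2, h3, h4, h5, h6, h7⟩ := pow_bounds hb
  have ha := hb.pos
  by_cases hA : a ^ (m + 2) ≤ κ - 1 / 200
  · have haa : a ≤ a' := by
      rw [hs.a_eq']
      have := drift_le hb hμ
      have : 0 ≤ η * a ^ m * (z - a * a ^ (m + 2) - a * a ^ m * (X - a ^ 2)) := by
        apply mul_nonneg (by positivity)
        nlinarith
      linarith
    exact hℓ.trans (pow_le_pow_left₀ ha.le haa _)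
  · push Not at hA
    refine le_trans ?_ (hs.pow_le_pow_a hb hη (by linarith))
    have : (1 - 3 / 1000) * (κ - 1 / 200) ≤ (1 - 3 * (η * (m + 2))) * a ^ (m + 2) := by
      apply mul_le_mul (by linarith) hA.le (by linarith) (by linarith)
    linarith

/-- Outside the cone `a / 5 ≤ z`, the level `1 / 5` is not crossed upwards. -/
lemma pow_le_fifth (hs : ScalarStep m η a z X a' z' X') (hb : NearBalanced m μ a z X)
    (hη : 0 < η) (hηm : η * (m + 2) ≤ 1 / 1000)
    (hA : a ^ (m + 2) ≤ 1 / 5) (hz : z < 1 / 5 * a) : a' ^ (m + 2) ≤ 1 / 5 := by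
  obtain ⟨h1, h2, h3, h4, h5, h6, h7⟩ := pow_bounds hb
  have ha := hb.pos
  have hη' : η ≤ 1 / 1000 := by nlinarith [(Nat.cast_nonneg m : (0 : ℝ) ≤ m)]
  have hD0 : 0 ≤ X - a ^ 2 := by linarith [hb.bal_low]
  have hA0 : 0 < a ^ (m + 2) := pow_pos ha _
  have hPD0 : 0 ≤ a * a ^ m * (X - a ^ 2) := by positivity
  have ha'0 : 0 < a' := lt_of_lt_of_le (mul_pos ha (by linarith)) (hs.le_a hb hη)
  have ea := hs.a_eq'
  set t := 1 / 5 - a ^ (m + 2) with ht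
  have ht0 : 0 ≤ t := by linarith
  have hηt : η * t ≤ 1 / 1000 := by
    calc η * t ≤ 1 / 1000 * 1 := by gcongr; linarith
      _ = _ := by ring
  have hηt0 : 0 ≤ η * t := by positivity
  have up : a' ≤ a * (1 + η * t) := by
    have e1 : z - a * a ^ (m + 2) - a * a ^ m * (X - a ^ 2) ≤ a * t := by rw [ht]; linarith
    have e2 : η * a ^ m * (a * t) ≤ η * 1 * (a * t) := by gcongr
    have e3 : η * a ^ m * (z - a * a ^ (m + 2) - a * a ^ m * (X - a ^ 2)) ≤ η * a ^ m * (a * t) := by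
      gcongr
    linarith
  have hber : 1 + ((m + 2 : ℕ) : ℝ) * (-(η * t)) ≤ (1 + -(η * t)) ^ (m + 2) :=
    one_add_mul_le_pow (by linarith) _
  push_cast at hber
  have hx : a' * (1 + -(η * t)) ≤ a := by
    have : 0 ≤ 1 + -(η * t) := by linarith
    calc a' * (1 + -(η * t)) ≤ a * (1 + η * t) * (1 + -(η * t)) := by gcongr
      _ = a - a * (η * t) ^ 2 := by ring
      _ ≤ a := by linarith [mul_nonneg ha.le (sq_nonneg (η * t))]
  have hpow : a' ^ (m + 2) * (1 + -(η * t)) ^ (m + 2) ≤ a ^ (m + 2) := by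
    rw [← mul_pow]
    exact pow_le_pow_left₀ (mul_nonneg ha'0.le (by linarith)) hx _
  have hmt : η * (m + 2) * t ≤ 1 / 1000 * t := by gcongr
  have h2' : a' ^ (m + 2) * (1 - 1 / 1000 * t) ≤ a ^ (m + 2) := by
    refine le_trans ?_ hpow
    have := pow_pos ha'0 (m + 2)
    gcongr
    linarith
  by_contra hcon
  push Not at hcon
  have e1 : 1 / 5 * (1 - 1 / 1000 * t) < a' ^ (m + 2) * (1 - 1 / 1000 * t) := by
    apply mul_lt_mul_of_pos_right hcon
    linarith
  linarith

/-- Outside the cone `a / 5 ≤ z`, the quantity `a (a + z) / (a - z)` does not decrease. -/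
lemma ratio_step (hs : ScalarStep m η a z X a' z' X') (hb : NearBalanced m μ a z X)
    (hη : 0 < η) (hηm : η * (m + 2) ≤ 1 / 1000) (hμ : μ ≤ 19 / 100)
    (hA : a ^ (m + 2) ≤ 1 / 5) (hz : z < 1 / 5 * a) (hu : μ ≤ a + z) (hu0 : 0 < a + z) {r s : ℝ}
    (hr : 0 ≤ r) (hs0 : 0 ≤ s) (h : s * (a - z) ≤ r * (a * (a + z))) :
    0 < a' + z' ∧ s * (a' - z') ≤ r * (a' * (a' + z')) := by
  obtain ⟨h1, h2, h3, h4, h5, h6, h7⟩ := pow_bounds hb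
  have ha := hb.pos
  have hzz := (abs_le.1 (abs_z_le hs hb)).1
  have hdr := drift_le hb hμ
  have hη' : η ≤ 1 / 1000 := by nlinarith [(Nat.cast_nonneg m : (0 : ℝ) ≤ m)]
  have hD0 : 0 ≤ X - a ^ 2 := by linarith [hb.bal_low]
  have hA0 : 0 < a ^ (m + 2) := pow_pos ha _
  set k := η * a ^ m with hk
  have hk0 : 0 < k := by positivity
  have hkη : k ≤ η := by nlinarith
  have hPD : a * a ^ m * (X - a ^ 2) ≤ 1 / 100 * (a + z) := by
    have : a * a ^ m ≤ 1 := by nlinarith [hb.le_one]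
    nlinarith [hb.bal_high]
  have hPD0 : 0 ≤ a * a ^ m * (X - a ^ 2) := by positivity
  have ea : a' = a + k * (z - a * a ^ (m + 2) - a * a ^ m * (X - a ^ 2)) := hs.a_eq'
  have ez : z' = z + k * (a - a ^ (m + 2) * z) := by rw [hs.z_eq, hk]; ring
  have ha'0 : 0 < a' := lt_of_lt_of_le (mul_pos ha (by linarith)) (hs.le_a hb hη)
  have ba : a * (1 - 13 / 10 * k) ≤ a' := by
    have e1 : a * a ^ (m + 2) ≤ a * (1 / 5) := by gcongr
    have e2 : -(13 / 10 * a) ≤ z - a * a ^ (m + 2) - a * a ^ m * (X - a ^ 2) := by linarith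
    have := mul_le_mul_of_nonneg_left e2 hk0.le
    rw [ea]; linarith
  have bu : (a + z) * (1 + 7 / 10 * k) ≤ a' + z' := by
    have : a' + z' = (a + z) + k * ((1 - a ^ (m + 2)) * (a + z) - a * a ^ m * (X - a ^ 2)) := by
      rw [ea, ez]; ring
    rw [this]
    have e1 : a ^ (m + 2) * (a + z) ≤ 1 / 5 * (a + z) := by gcongr
    have e2 : 7 / 10 * (a + z) ≤ (1 - a ^ (m + 2)) * (a + z) - a * a ^ m * (X - a ^ 2) := by
      linarith
    have := mul_le_mul_of_nonneg_left e2 hk0.le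
    linarith
  have bp : a' - z' ≤ (a - z) * (1 - k) := by
    have : a' - z' = (a - z) * (1 - k) - k * (a ^ (m + 2) * (a - z) + a * a ^ m * (X - a ^ 2)) := by
      rw [ea, ez]; ring
    rw [this]
    have : 0 ≤ a ^ (m + 2) * (a - z) := mul_nonneg hA0.le (by linarith)
    have := mul_nonneg hk0.le (add_nonneg this hPD0)
    linarith
  refine ⟨lt_of_lt_of_le (by positivity) bu, ?_⟩
  · have e1 : a * (a + z) * (1 - k) ≤ a' * (a' + z') := by
      calc a * (a + z) * (1 - k) ≤ (a * (1 - 13 / 10 * k)) * ((a + z) * (1 + 7 / 10 * k)) := by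
            have : 0 < a * (a + z) := by positivity
            have hk2 : k * k ≤ k * (1 / 1000) :=
              mul_le_mul_of_nonneg_left (hkη.trans hη') hk0.le
            have : 1 - k ≤ (1 - 13 / 10 * k) * (1 + 7 / 10 * k) := by ring_nf at hk2 ⊢; linarith
            calc _ ≤ a * (a + z) * ((1 - 13 / 10 * k) * (1 + 7 / 10 * k)) := by gcongr
              _ = _ := by ring
        _ ≤ a' * (a' + z') := by
            apply mul_le_mul ba bu (by positivity) ha'0.le
    calc s * (a' - z') ≤ s * ((a - z) * (1 - k)) := by gcongr
      _ = s * (a - z) * (1 - k) := by ring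
      _ ≤ r * (a * (a + z)) * (1 - k) := by
          exact mul_le_mul_of_nonneg_right h (by linarith)
      _ = r * (a * (a + z) * (1 - k)) := by ring
      _ ≤ r * (a' * (a' + z')) := by gcongr

/-- The angle to the target contracts geometrically. -/
lemma angle_step (hs : ScalarStep m η a z X a' z' X') (hb : NearBalanced m μ a z X)
    (hη : 0 < η) (hη' : η ≤ 1 / 1000) (hμ0 : 0 < μ) (hza : z ≤ a) (hu : μ ≤ a + z) {C : ℝ}
    (hC : 0 ≤ C) (h : a - z ≤ C * (a + z)) :
    a' - z' ≤ C * (1 - 19 / 10 * (η * μ)) * (a' + z') := by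
  obtain ⟨h1, h2, h3, h4, h5, h6, h7⟩ := pow_bounds hb
  have ha := hb.pos
  have hD0 : 0 ≤ X - a ^ 2 := by linarith [hb.bal_low]
  have hA0 : 0 < a ^ (m + 2) := pow_pos ha _
  have hA1 : a ^ (m + 2) ≤ 1 := h7.trans hb.le_one
  set k := η * a ^ m with hk
  have hk0 : 0 < k := by positivity
  have hkη : k ≤ η := by nlinarith
  have hkμ : η * μ ≤ k := by rw [hk]; gcongr; exact hb.low.trans h6
  have hPD : a * a ^ m * (X - a ^ 2) ≤ 1 / 100 * (a + z) := by
    have : a * a ^ m ≤ 1 := by nlinarith [hb.le_one]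
    nlinarith [hb.bal_high]
  have hPD0 : 0 ≤ a * a ^ m * (X - a ^ 2) := by positivity
  have ea : a' = a + k * (z - a * a ^ (m + 2) - a * a ^ m * (X - a ^ 2)) := hs.a_eq'
  have ez : z' = z + k * (a - a ^ (m + 2) * z) := by rw [hs.z_eq, hk]; ring
  set A := a ^ (m + 2)
  have hu0 : 0 < a + z := by linarith
  have bp : a' - z' ≤ (a - z) * (1 - k * (1 + A)) := by
    have : a' - z' = (a - z) * (1 - k * (1 + A)) - k * (a * a ^ m * (X - a ^ 2)) := by
      rw [ea, ez]; ring
    rw [this]; nlinarith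
  have bu : (a + z) * (1 + k * (1 - A) - 1 / 100 * k) ≤ a' + z' := by
    have : a' + z' = (a + z) * (1 + k * (1 - A)) - k * (a * a ^ m * (X - a ^ 2)) := by
      rw [ea, ez]; ring
    rw [this]; nlinarith
  have hu'0 : 0 ≤ a' + z' := by
    refine le_trans (mul_nonneg hu0.le ?_) bu
    nlinarith
  have hkk : 1 - k * (1 + A) ≤ (1 + k * (1 - A) - 1 / 100 * k) * (1 - 19 / 10 * k) := by
    nlinarith [mul_pos hk0 hk0, mul_pos hk0 hA0]
  have hk1 : 0 ≤ 1 - 19 / 10 * k := by linarith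
  calc a' - z' ≤ (a - z) * (1 - k * (1 + A)) := bp
    _ ≤ C * (a + z) * (1 - k * (1 + A)) := by
        apply mul_le_mul_of_nonneg_right h; nlinarith
    _ ≤ C * (a + z) * ((1 + k * (1 - A) - 1 / 100 * k) * (1 - 19 / 10 * k)) := by gcongr
    _ = C * ((a + z) * (1 + k * (1 - A) - 1 / 100 * k)) * (1 - 19 / 10 * k) := by ring
    _ ≤ C * (a' + z') * (1 - 19 / 10 * k) := by gcongr
    _ ≤ C * (a' + z') * (1 - 19 / 10 * (η * μ)) := by gcongr
    _ = _ := by ring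

/-- Inside the cone `3 a / 5 ≤ z`, small values of `a ^ (m + 2)` grow geometrically. -/
lemma growth_step (hs : ScalarStep m η a z X a' z' X') (hb : NearBalanced m μ a z X)
    (hη : 0 < η) (hμ0 : 0 < μ) (hμ : μ ≤ 19 / 100) (hz : 3 / 5 * a ≤ z)
    (hA : a ^ (m + 2) ≤ 1 / 4) :
    a ^ (m + 2) * (1 + 17 / 50 * ((m + 2) * (η * μ))) ≤ a' ^ (m + 2) := by
  obtain ⟨h1, h2, h3, h4, h5, h6, h7⟩ := pow_bounds hb
  have ha := hb.pos
  have hdr := drift_le hb hμ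
  have hkμ : η * μ ≤ η * a ^ m := by gcongr; exact hb.low.trans h6
  have up : a * (1 + 17 / 50 * (η * μ)) ≤ a' := by
    have e : 17 / 50 * a ≤ z - a * a ^ (m + 2) - a * a ^ m * (X - a ^ 2) := by nlinarith
    calc a * (1 + 17 / 50 * (η * μ)) = a + η * μ * (17 / 50 * a) := by ring
      _ ≤ a + η * a ^ m * (17 / 50 * a) := by gcongr
      _ ≤ a' := by rw [hs.a_eq']; gcongr
  have hημ : 0 < η * μ := by positivity
  have hber : 1 + ((m + 2 : ℕ) : ℝ) * (17 / 50 * (η * μ)) ≤ (1 + 17 / 50 * (η * μ)) ^ (m + 2) :=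
    one_add_mul_le_pow (by linarith) _
  push_cast at hber
  calc _ ≤ a ^ (m + 2) * (1 + 17 / 50 * (η * μ)) ^ (m + 2) := by
        gcongr
        linarith
    _ = (a * (1 + 17 / 50 * (η * μ))) ^ (m + 2) := by rw [mul_pow]
    _ ≤ a' ^ (m + 2) := pow_le_pow_left₀ (by positivity) up _

end ScalarStep

/-- The squared residual `‖a ^ (m + 1) • x - Λ‖²` in scalar coordinates. -/
def scalarResidual (m : ℕ) (a z X : ℝ) : ℝ := (a ^ (m + 1)) ^ 2 * X - 2 * a ^ (m + 1) * z + 1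

/-- The initial phase, in which `x` has not yet turned towards the target. -/
structure Turning (m : ℕ) (s r a z : ℝ) : Prop where
  level : a ^ (m + 2) ≤ 1 / 5
  out : z < 1 / 5 * a
  pos : 0 < a + z
  ratio : s * (a - z) ≤ r * (a * (a + z))

lemma Turning.le {m : ℕ} {s r a z c : ℝ} (h : Turning m s r a z) (ha : 0 < a) (hr : 0 ≤ r)
    (hs : 0 < s) (hc : 3 / 2 * r ≤ c) : s ≤ c * a ∧ s ≤ c * (a + z) := by
  have h1 := h.out
  have h2 := h.ratio
  have h3 : s * (4 / 5) ≤ r * (a + z) := by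
    have : s * (4 / 5 * a) ≤ s * (a - z) := by
      apply mul_le_mul_of_nonneg_left _ hs.le
      linarith
    have : a * (s * (4 / 5)) ≤ a * (r * (a + z)) := by linarith
    exact le_of_mul_le_mul_left this ha
  have h4 : r * (a + z) ≤ r * (6 / 5 * a) := by
    apply mul_le_mul_of_nonneg_left _ hr
    linarith
  have h5 := mul_le_mul_of_nonneg_right hc ha.le
  have h6 := mul_le_mul_of_nonneg_right hc h.pos.le
  constructor <;> linarith

/-- The invariant maintained along the trajectory. -/
structure FlowInv (m : ℕ) (μ s r a z X : ℝ) : Prop where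
  nb : NearBalanced m μ a z X
  res : scalarResidual m a z X ≤ 36 / 25
  phase : Turning m s r a z ∨ 1 / 5 * a ≤ z

section trajectory

variable {m K : ℕ} {η s r c : ℝ} {a z X : ℕ → ℝ}

lemma FlowInv.le_sum {μ a z X : ℝ} (hI : FlowInv m μ s r a z X) (hr : 0 ≤ r) (hs : 0 < s) (hs1 : s ≤ 1)
    (hc1 : 1 ≤ c) (hc : 3 / 2 * r ≤ c) (hμ : μ ≤ (s / c) ^ (m + 2)) : μ ≤ a + z := by
  rcases hI.phase with h | h
  · have hsc : s / c ≤ a + z := by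
      rw [div_le_iff₀ (by linarith)]
      linarith [(h.le hI.nb.pos hr hs hc).2]
    have h0 : 0 ≤ s / c := by positivity
    have h1 : s / c ≤ 1 := by rw [div_le_one (by linarith)]; linarith
    exact (hμ.trans (pow_le_of_le_one h0 h1 (by omega))).trans hsc
  · have := (ScalarStep.pow_bounds hI.nb).2.2.2.2.2.2
    linarith [hI.nb.low, hI.nb.pos]

/-- One step preserves the invariant, given the bound on the imbalance. -/
lemma FlowInv.step {a z X a' z' X' : ℝ} (hst : ScalarStep m η a z X a' z' X')
    (hη : 0 < η) (hηm : η * (m + 2) ≤ 1 / 1000) (hr : 0 ≤ r) (hs : 0 < s) (hs1 : s ≤ 1)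
    (hs5 : s ^ (m + 2) ≤ 1 / 5) (hc1 : 1 ≤ c) (hc : 3 / 2 * r ≤ c)
    (hI : FlowInv m (19 / 20 * (s / c) ^ (m + 2)) s r a z X)
    (hbal : X' - a' ^ 2 ≤ 1 / 100 * (19 / 20 * (s / c) ^ (m + 2))) :
    FlowInv m (19 / 20 * (s / c) ^ (m + 2)) s r a' z' X' := by
  have h0 : 0 ≤ s / c := by positivity
  have hμ5 : (s / c) ^ (m + 2) ≤ 1 / 5 :=
    (pow_le_pow_left₀ h0 (div_le_self hs.le hc1) _).trans hs5
  have hμ0 : 0 ≤ (s / c) ^ (m + 2) := by positivity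
  have hη' : η ≤ 1 / 1000 := by nlinarith [(Nat.cast_nonneg m : (0 : ℝ) ≤ m)]
  have hsum := hI.le_sum hr hs hs1 hc1 hc (by linarith)
  set μ₀ := (s / c) ^ (m + 2) with hμ₀
  have hb := hI.nb
  have ha'0 : 0 < a' := lt_of_lt_of_le (mul_pos hb.pos (by linarith)) (hst.le_a hb hη)
  have himb := hst.imbalance hb hη (by linarith) hI.res
  have hlow : 19 / 20 * μ₀ ≤ a' ^ (m + 2) := by
    rcases hI.phase with h | h
    · have hsc : s / c ≤ a := by
        rw [div_le_iff₀ (by linarith)]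
        linarith [(h.le hb.pos hr hs hc).1]
      have h1 : μ₀ ≤ a ^ (m + 2) := pow_le_pow_left₀ h0 hsc _
      refine le_trans ?_ (hst.pow_le_pow_a hb hη (by linarith))
      apply mul_le_mul (by linarith) h1 hμ0 (by linarith)
    · exact hst.level_le hb hη hηm (by linarith) h hb.low (by norm_num) (by linarith)
  refine ⟨⟨ha'0, hst.a_le_one hb hη (by linarith), hlow, by linarith [himb.1], by linarith⟩, ?_, ?_⟩
  · refine (hst.residual_le hb hη (by linarith)).trans ?_
    have hR0 := ScalarStep.residual_nonneg (a ^ (m + 1)) hst.cs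
    have hP1 : a ^ (m + 1) ≤ 1 := pow_le_one₀ hb.pos.le hb.le_one
    have hP0 : 0 ≤ a ^ (m + 1) := pow_nonneg hb.pos.le _
    have hP'1 : a' ^ (m + 1) ≤ 1 := pow_le_one₀ ha'0.le (hst.a_le_one hb hη (by linarith))
    have hP'0 : 0 ≤ a' ^ (m + 1) := pow_nonneg ha'0.le _
    have hP2 : η * a ^ (m + 1) * a' ^ (m + 1) ≤ 1 / 1000 * 1 * 1 := by gcongr
    have hP3 : 0 ≤ η * a ^ (m + 1) * a' ^ (m + 1) := by positivity
    refine (mul_le_of_le_one_left hR0 (pow_le_one₀ ?_ ?_)).trans hI.res <;> linarith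
  · by_cases hz : z' < 1 / 5 * a'
    · left
      rcases hI.phase with h | h
      · obtain ⟨h1, h2⟩ := hst.ratio_step hb hη hηm (by linarith) h.level h.out hsum h.pos hr hs.le
          h.ratio
        exact ⟨hst.pow_le_fifth hb hη hηm h.level h.out, hz, h1, h2⟩
      · exact absurd (hst.cone hb hη (by linarith) (by norm_num) (by norm_num) h) (not_le.2 hz)
    · exact Or.inr (not_lt.1 hz)

lemma inv_trajectory (hst : ∀ j, ScalarStep m η (a j) (z j) (X j) (a (j + 1)) (z (j + 1)) (X (j + 1)))
    (hη : 0 < η) (hηm : η * (m + 2) ≤ 1 / 1000) (hr : 0 ≤ r) (hs : 0 < s) (hs1 : s ≤ 1)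
    (hs5 : s ^ (m + 2) ≤ 1 / 5) (hc1 : 1 ≤ c) (hc : 3 / 2 * r ≤ c)
    (hI : FlowInv m (19 / 20 * (s / c) ^ (m + 2)) s r (a 0) (z 0) (X 0)) (hX0 : X 0 = a 0 ^ 2)
    (hK : 36 / 25 * η ^ 2 * K ≤ 1 / 100 * (19 / 20 * (s / c) ^ (m + 2))) {j : ℕ} (hj : j ≤ K) :
    FlowInv m (19 / 20 * (s / c) ^ (m + 2)) s r (a j) (z j) (X j) := by
  have hη' : η ≤ 1 / 1000 := by nlinarith [(Nat.cast_nonneg m : (0 : ℝ) ≤ m)]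
  suffices FlowInv m (19 / 20 * (s / c) ^ (m + 2)) s r (a j) (z j) (X j) ∧
      X j - a j ^ 2 ≤ 36 / 25 * η ^ 2 * j from this.1
  induction j with
  | zero => exact ⟨hI, by simp [hX0]⟩
  | succ j ih =>
    obtain ⟨h1, h2⟩ := ih (by omega)
    have h3 := ((hst j).imbalance h1.nb hη (by linarith) h1.res).2
    have h4 : X (j + 1) - a (j + 1) ^ 2 ≤ 36 / 25 * η ^ 2 * (j + 1 : ℕ) := by
      push_cast
      linarith
    refine ⟨h1.step (hst j) hη hηm hr hs hs1 hs5 hc1 hc (h4.trans (le_trans ?_ hK)), h4⟩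
    gcongr

lemma residual_trajectory
    (hst : ∀ j, ScalarStep m η (a j) (z j) (X j) (a (j + 1)) (z (j + 1)) (X (j + 1)))
    (hη : 0 < η) (hηm : η * (m + 2) ≤ 1 / 1000) (hr : 0 ≤ r) (hs : 0 < s) (hs1 : s ≤ 1)
    (hs5 : s ^ (m + 2) ≤ 1 / 5) (hc1 : 1 ≤ c) (hc : 3 / 2 * r ≤ c) {μ : ℝ}
    (hμ : μ = 19 / 20 * (s / c) ^ (m + 2))
    (hI : FlowInv m μ s r (a 0) (z 0) (X 0)) (hX0 : X 0 = a 0 ^ 2)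
    (hr0 : a 0 - z 0 ≤ r * (a 0 + z 0))
    {k₁ k₂ k₃ : ℕ} (hK : 36 / 25 * η ^ 2 * (k₁ + k₂ + k₃ : ℕ) ≤ 1 / 100 * μ)
    (hk₁ : r * (1 - 19 / 10 * (η * μ)) ^ k₁ ≤ 1 / 4)
    (hk₂ : 1 / 4 ≤ μ * (1 + 17 / 50 * ((m + 2) * (η * μ))) ^ k₂) :
    scalarResidual m (a (k₁ + k₂ + k₃)) (z (k₁ + k₂ + k₃)) (X (k₁ + k₂ + k₃)) ≤
      36 / 25 * ((1 - η / 16) ^ 2) ^ k₃ := by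
  have hη' : η ≤ 1 / 1000 := by nlinarith [(Nat.cast_nonneg m : (0 : ℝ) ≤ m)]
  have hInv : ∀ {j}, j ≤ k₁ + k₂ + k₃ → FlowInv m μ s r (a j) (z j) (X j) := by
    subst hμ
    exact fun hj => inv_trajectory hst hη hηm hr hs hs1 hs5 hc1 hc hI hX0 hK hj
  have hsc : 0 < (s / c) ^ (m + 2) := by positivity
  have hμ0 : 0 < μ := by rw [hμ]; positivity
  have hμ5 : (s / c) ^ (m + 2) ≤ 1 / 5 :=
    (pow_le_pow_left₀ (by positivity) (div_le_self hs.le hc1) _).trans hs5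
  have hμ1 : μ ≤ 19 / 100 := by linarith
  have hημ : η * μ ≤ 1 / 1000 := by nlinarith
  have hang : ∀ j, j ≤ k₁ + k₂ + k₃ → 3 / 5 * a j ≤ z j ∨
      a j - z j ≤ r * (1 - 19 / 10 * (η * μ)) ^ j * (a j + z j) := by
    intro j hj
    induction j with
    | zero => right; simpa using hr0
    | succ j ih =>
      have hIj := hInv (show j ≤ k₁ + k₂ + k₃ by omega)
      by_cases hz : 3 / 5 * a j ≤ z j
      · exact Or.inl ((hst j).cone hIj.nb hη (by linarith) (by norm_num) (by norm_num) hz)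
      · right
        have h1 := (ih (by omega)).resolve_left hz
        have h2 := (hst j).angle_step hIj.nb hη hη' hμ0 (by linarith [hIj.nb.pos])
          (hIj.le_sum hr hs hs1 hc1 hc (by linarith))
          (mul_nonneg hr (pow_nonneg (by linarith) _)) h1
        rwa [mul_assoc r, ← pow_succ] at h2
  have hcone : ∀ i, k₁ + i ≤ k₁ + k₂ + k₃ → 3 / 5 * a (k₁ + i) ≤ z (k₁ + i) := by
    intro i hi
    induction i with
    | zero =>
      have hIj := hInv (show k₁ ≤ k₁ + k₂ + k₃ by omega)
      have hsum := hIj.le_sum hr hs hs1 hc1 hc (by linarith)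
      rcases hang k₁ (by omega) with h | h
      · exact h
      · have h2 := mul_le_mul_of_nonneg_right hk₁ (hμ0.le.trans hsum)
        simp only [add_zero]
        linarith
    | succ i ih =>
      exact (hst (k₁ + i)).cone (hInv (show k₁ + i ≤ k₁ + k₂ + k₃ by omega)).nb hη (by linarith)
        (by norm_num) (by norm_num) (ih (by omega))
  have hquarter : ∀ j, k₁ ≤ j → j + 1 ≤ k₁ + k₂ + k₃ → 1 / 4 ≤ a j ^ (m + 2) →
      1 / 4 ≤ a (j + 1) ^ (m + 2) := by
    intro j hj1 hj2 h
    have h1 := hcone (j - k₁) (by omega)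
    rw [Nat.add_sub_cancel' hj1] at h1
    exact (hst j).level_le (hInv (show j ≤ k₁ + k₂ + k₃ by omega)).nb hη hηm hμ1 h1 h (by norm_num)
      (by norm_num)
  have hgrow : ∀ i, k₁ + i ≤ k₁ + k₂ + k₃ → 1 / 4 ≤ a (k₁ + i) ^ (m + 2) ∨
      μ * (1 + 17 / 50 * ((m + 2) * (η * μ))) ^ i ≤ a (k₁ + i) ^ (m + 2) := by
    intro i hi
    induction i with
    | zero => right; simpa using (hInv (show k₁ ≤ k₁ + k₂ + k₃ by omega)).nb.low
    | succ i ih =>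
      by_cases hA : 1 / 4 ≤ a (k₁ + i) ^ (m + 2)
      · exact Or.inl (hquarter (k₁ + i) (by omega) hi hA)
      · right
        have h1 := (ih (by omega)).resolve_left hA
        have h2 := (hst (k₁ + i)).growth_step (hInv (show k₁ + i ≤ k₁ + k₂ + k₃ by omega)).nb hη hμ0
          hμ1 (hcone i (by omega)) (not_le.1 hA).le
        rw [pow_succ, ← mul_assoc]
        exact (mul_le_mul_of_nonneg_right h1 (by positivity)).trans h2
  have hlarge : ∀ i, k₁ + k₂ + i ≤ k₁ + k₂ + k₃ → 1 / 4 ≤ a (k₁ + k₂ + i) ^ (m + 2) := by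
    intro i hi
    induction i with
    | zero =>
      rcases hgrow k₂ (by omega) with h | h
      · exact h
      · exact hk₂.trans h
    | succ i ih => exact hquarter (k₁ + k₂ + i) (by omega) hi (ih (by omega))
  have hres : ∀ i, k₁ + k₂ + i ≤ k₁ + k₂ + k₃ →
      scalarResidual m (a (k₁ + k₂ + i)) (z (k₁ + k₂ + i)) (X (k₁ + k₂ + i)) ≤
        36 / 25 * ((1 - η / 16) ^ 2) ^ i := by
    intro i hi
    induction i with
    | zero => simpa using (hInv (show k₁ + k₂ ≤ k₁ + k₂ + k₃ by omega)).res
    | succ i ih =>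
      have hlevel : ∀ j, j ≤ k₁ + k₂ + k₃ → 1 / 4 ≤ a j ^ (m + 2) → 1 / 4 ≤ a j ^ (m + 1) := by
        intro j hj h
        have hb := (hInv hj).nb
        exact h.trans (pow_le_pow_of_le_one hb.pos.le hb.le_one (by omega))
      have hb := (hInv (show k₁ + k₂ + i ≤ k₁ + k₂ + k₃ by omega)).nb
      have hb' := (hInv hi).nb
      have e1 := hlevel _ (by omega) (hlarge i (by omega))
      have e2 := hlevel _ hi (hlarge (i + 1) hi)
      have e3 : 1 / 16 ≤ a (k₁ + k₂ + i) ^ (m + 1) * a (k₁ + k₂ + (i + 1)) ^ (m + 1) := by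
        calc (1 : ℝ) / 16 = 1 / 4 * (1 / 4) := by norm_num
          _ ≤ _ := mul_le_mul e1 e2 (by norm_num) (by linarith)
      have e4 : a (k₁ + k₂ + i) ^ (m + 1) * a (k₁ + k₂ + (i + 1)) ^ (m + 1) ≤ 1 :=
        mul_le_one₀ (pow_le_one₀ hb.pos.le hb.le_one) (by linarith)
          (pow_le_one₀ hb'.pos.le hb'.le_one)
      have e5 := mul_le_mul_of_nonneg_left e3 hη.le
      have e6 := mul_le_mul_of_nonneg_left e4 hη.le
      have h1 := (hst (k₁ + k₂ + i)).residual_le hb hη (by linarith)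
      have hR0 := ScalarStep.residual_nonneg (a (k₁ + k₂ + i) ^ (m + 1)) (hst (k₁ + k₂ + i)).cs
      refine h1.trans ((mul_comm _ _).le.trans ?_)
      rw [pow_succ ((1 - η / 16) ^ 2) i, ← mul_assoc (36 / 25)]
      refine mul_le_mul (ih (by omega)) (pow_le_pow_left₀ ?_ ?_ 2) (sq_nonneg _) (by positivity)
      · rw [mul_assoc, show k₁ + k₂ + i + 1 = k₁ + k₂ + (i + 1) by ring]; linarith
      · rw [mul_assoc, show k₁ + k₂ + i + 1 = k₁ + k₂ + (i + 1) by ring]; linarith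
  exact hres k₃ le_rfl

end trajectory

lemma log_bounds {N M ρ ε : ℝ} (hN : 2 ≤ N) (hM : 1 ≤ M) (hρ0 : 0 < ρ) (hε0 : 0 < ε) :
    3 + Real.log M - Real.log ρ - Real.log ε ≤ Real.log (15 * N * M / (ρ * ε)) := by
  have h1 : Real.log (15 * N * M / (ρ * ε)) =
      Real.log (15 * N) + Real.log M - Real.log ρ - Real.log ε := by
    rw [Real.log_div (by positivity) (by positivity),
      Real.log_mul (x := 15 * N) (y := M) (by positivity) (by positivity),
      Real.log_mul (x := ρ) (y := ε) (by positivity) (by positivity)]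
    ring
  have h2 : 3 ≤ Real.log (15 * N) := by
    rw [Real.le_log_iff_exp_le (by positivity)]
    have h3 : Real.exp 3 = Real.exp 1 ^ 3 := by rw [← Real.exp_nat_mul]; norm_num
    have h4 : Real.exp 1 ^ 3 ≤ 2.7182818286 ^ 3 :=
      pow_le_pow_left₀ (Real.exp_pos _).le Real.exp_one_lt_d9.le _
    rw [h3]
    norm_num at h4 ⊢
    linarith
  linarith

/-- The three phases of the iteration fit into the total budget. -/
lemma phase_budget {η μ N L lM lc lρ lε lμ l4 : ℝ} (hη : 0 < η) (hμ : 0 < μ) (hμ5 : μ ≤ 1 / 5)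
    (hη1 : η ≤ 1 / 100) (hN : 2 ≤ N) (hlM : 0 ≤ lM) (hlρ : lρ ≤ 0) (hlε : lε ≤ 0)
    (hlμ : -lμ = N * lc - lρ) (hlc : lc ≤ 1 / 2 + lM) (hl4 : l4 ≤ 7 / 5 + lM)
    (hL : 3 + lM - lρ - lε ≤ L) :
    l4 / (19 / 10 * (η * (19 / 20 * μ))) +
      -lμ / (33 / 34 * (17 / 50 * (N * (η * (19 / 20 * μ))))) + 2 + 8 * (-lε) / η ≤
      2 * N * L / (η * μ) := by
  have hN0 : 0 < N := by linarith
  have e1 : l4 / (19 / 10 * (η * (19 / 20 * μ))) +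
      -lμ / (33 / 34 * (17 / 50 * (N * (η * (19 / 20 * μ))))) + 2 + 8 * (-lε) / η =
      (l4 * (200 / 361) + -lμ / N * (2000 / 627) + 2 * (η * μ) + 8 * μ * (-lε)) / (η * μ) := by
    field_simp
    ring
  have e2 : -lμ / N ≤ lc + (-lρ) / 2 := by
    rw [hlμ, sub_eq_add_neg, add_div, mul_div_cancel_left₀ _ hN0.ne']
    gcongr
    linarith
  have e3 : 8 * μ * (-lε) ≤ 8 * (1 / 5) * (-lε) := by
    gcongr
    linarith
  have e4 : 4 * L ≤ 2 * N * L := by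
    have : 0 ≤ L := by linarith
    nlinarith
  have e5 : η * μ ≤ 1 / 100 * (1 / 5) := by gcongr
  rw [e1]
  gcongr
  linarith

set_option maxHeartbeats 1000000 in
/-- Splitting of the iteration budget: turning, growth, and final convergence. -/
lemma exists_phase_lengths {m K : ℕ} {η s r ε L M c μ₀ : ℝ} (hη : 0 < η) (hs : 0 < s)
    (hs5 : s ^ (m + 2) ≤ 1 / 5) (hε0 : 0 < ε) (hε1 : ε ≤ 1)
    (hM : M = max 1 r) (hc : c = max 1 (3 / 2 * r)) (hμ₀ : μ₀ = (s / c) ^ (m + 2))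
    (hL : L = Real.log (15 * ((m + 2 : ℕ) : ℝ) * M / (s ^ (m + 2) * ε)))
    (hsmall : (m + 2) * L * η ≤ 1 / 10 ^ 6 * μ₀ ^ 2)
    (hK : K = ⌊2 * ((m + 2 : ℕ) : ℝ) * c ^ (m + 2) / (s ^ (m + 2) * η) * L + 1⌋₊) :
    η * (m + 2) ≤ 1 / 1000 ∧ ∃ k₁ k₂ k₃ : ℕ, K = k₁ + k₂ + k₃ ∧
      36 / 25 * η ^ 2 * K ≤ 1 / 100 * (19 / 20 * μ₀) ∧
      r * (1 - 19 / 10 * (η * (19 / 20 * μ₀))) ^ k₁ ≤ 1 / 4 ∧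
      1 / 4 ≤ 19 / 20 * μ₀ * (1 + 17 / 50 * ((m + 2) * (η * (19 / 20 * μ₀)))) ^ k₂ ∧
      1 / 2 * (36 / 25 * ((1 - η / 16) ^ 2) ^ k₃) ≤ ε := by
  have hM1 : 1 ≤ M := hM ▸ le_max_left _ _
  have hrM : r ≤ M := hM ▸ le_max_right _ _
  have hc1 : 1 ≤ c := hc ▸ le_max_left _ _
  have hcM : c ≤ 3 / 2 * M := by
    rw [hc]
    apply max_le <;> linarith
  have hρ0 : 0 < s ^ (m + 2) := by positivity
  set N : ℝ := (m + 2 : ℝ) with hN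
  have hNcast : ((m + 2 : ℕ) : ℝ) = N := by push_cast; rfl
  rw [hNcast] at hL hK
  have hN2 : 2 ≤ N := by linarith [(Nat.cast_nonneg m : (0 : ℝ) ≤ m)]
  have hLb := log_bounds hN2 hM1 hρ0 hε0
  rw [← hL] at hLb
  have hlM : 0 ≤ Real.log M := Real.log_nonneg hM1
  have hlρ : Real.log (s ^ (m + 2)) ≤ 0 := Real.log_nonpos hρ0.le (by linarith)
  have hlε : Real.log ε ≤ 0 := Real.log_nonpos hε0.le hε1
  have hμ₀0 : 0 < μ₀ := by rw [hμ₀]; positivity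
  have hμ₀5 : μ₀ ≤ 1 / 5 := by
    rw [hμ₀]
    exact (pow_le_pow_left₀ (by positivity) (div_le_self hs.le hc1) _).trans hs5
  have hlc : Real.log c ≤ 1 / 2 + Real.log M := by
    have h1 := Real.log_le_log (by linarith) hcM
    rw [Real.log_mul (by norm_num) (by positivity)] at h1
    have h2 := Real.log_le_sub_one_of_pos (show (0 : ℝ) < 3 / 2 by norm_num)
    linarith
  have hlc0 : 0 ≤ Real.log c := Real.log_nonneg hc1
  have hlμ : -Real.log μ₀ = N * Real.log c - Real.log (s ^ (m + 2)) := by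
    rw [hμ₀, div_pow, Real.log_div (by positivity) (by positivity), Real.log_pow c, hNcast]
    ring
  have hNL : 6 ≤ N * L := by nlinarith
  have hμ₀sq : μ₀ ^ 2 ≤ 1 / 5 * μ₀ := by nlinarith
  have hη1 : 6 * η ≤ 1 / 10 ^ 6 * μ₀ ^ 2 := (by gcongr : 6 * η ≤ N * L * η).trans hsmall
  have hη1' : η ≤ 1 / 100 := by nlinarith
  have hNη : η * N ≤ 1 / 10 ^ 6 := by
    have : η * N * 1 ≤ η * N * L := by gcongr; linarith
    nlinarith
  refine ⟨by linarith, ?_⟩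
  have hημ0 : 0 < η * μ₀ := by positivity
  have hημ1 : η * μ₀ ≤ 1 / 10 ^ 6 := by nlinarith
  set Y := 2 * N * L / (η * μ₀) with hY
  have hYeq : 2 * N * c ^ (m + 2) / (s ^ (m + 2) * η) * L = Y := by
    rw [hY, hμ₀, div_pow]
    field_simp
  rw [hYeq] at hK
  have hL0 : 0 ≤ L := by linarith
  have hY0 : 0 ≤ Y := by positivity
  have hKle : (K : ℝ) ≤ Y + 1 := by rw [hK]; exact Nat.floor_le (by positivity)
  have hKge : Y ≤ K := by
    have := Nat.lt_floor_add_one (Y + 1)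
    rw [← hK] at this
    linarith
  set x := 19 / 10 * (η * (19 / 20 * μ₀)) with hx
  set y := 17 / 50 * (N * (η * (19 / 20 * μ₀))) with hy
  have hx0 : 0 < x := by positivity
  have hx1 : x ≤ 1 := by rw [hx]; linarith
  have hy0 : 0 < y := by positivity
  have hy1 : y ≤ 1 / 100 := by
    have : N * (η * (19 / 20 * μ₀)) ≤ 1 / 10 ^ 6 := by
      calc N * (η * (19 / 20 * μ₀)) = η * N * (19 / 20 * μ₀) := by ring
        _ ≤ 1 / 10 ^ 6 * 1 := by
          gcongr
          linarith
        _ = _ := by ring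
    rw [hy]
    linarith
  have hl4 : Real.log (4 * M) ≤ 7 / 5 + Real.log M := by
    rw [Real.log_mul (by norm_num) (by positivity)]
    have : Real.log 4 = 2 * Real.log 2 := by
      rw [show (4 : ℝ) = 2 ^ 2 by norm_num, Real.log_pow]
      norm_num
    linarith [Real.log_two_lt_d9]
  have hl40 : 0 ≤ Real.log (4 * M) := Real.log_nonneg (by linarith)
  obtain ⟨k₁, hk₁, hk₁'⟩ : ∃ k : ℕ, Real.log (4 * M) / x ≤ k ∧ (k : ℝ) ≤ Real.log (4 * M) / x + 1 :=
    ⟨_, Nat.le_ceil _, (Nat.ceil_lt_add_one (by positivity)).le⟩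
  have hB0 : 0 ≤ -Real.log μ₀ := by
    have := Real.log_nonpos hμ₀0.le (by linarith)
    linarith
  obtain ⟨k₂, hk₂, hk₂'⟩ : ∃ k : ℕ, -Real.log μ₀ / (33 / 34 * y) ≤ k ∧
      (k : ℝ) ≤ -Real.log μ₀ / (33 / 34 * y) + 1 :=
    ⟨_, Nat.le_ceil _, (Nat.ceil_lt_add_one (by positivity)).le⟩
  have hbudget : (k₁ : ℝ) + k₂ + 8 * (-Real.log ε) / η ≤ K := by
    refine le_trans ?_ hKge
    have e5 := phase_budget hη hμ₀0 hμ₀5 hη1' hN2 hlM hlρ hlε hlμ hlc hl4 hLb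
    rw [← hx, ← hy, ← hY] at e5
    linarith
  have hkle : k₁ + k₂ ≤ K := by
    have : 0 ≤ 8 * (-Real.log ε) / η := div_nonneg (by linarith) hη.le
    exact_mod_cast (by linarith : (k₁ : ℝ) + k₂ ≤ K)
  refine ⟨k₁, k₂, K - (k₁ + k₂), by omega, ?_, ?_, ?_, ?_⟩
  · have e1 : η ^ 2 * K ≤ η ^ 2 * (Y + 1) := by gcongr
    have e2 : η ^ 2 * (Y + 1) = 2 * (N * L * η) / μ₀ + η ^ 2 := by
      rw [hY]; field_simp
    have e3 : 2 * (N * L * η) / μ₀ ≤ 2 / 10 ^ 6 * μ₀ := by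
      rw [div_le_iff₀ hμ₀0]
      linarith
    have e4 : η ^ 2 ≤ 1 / 10 ^ 6 * μ₀ := by
      calc η ^ 2 ≤ η * 1 := by rw [sq]; gcongr; linarith
        _ ≤ 1 / 10 ^ 6 * μ₀ := by linarith
    linarith
  · have e1 : (1 - x) ^ k₁ ≤ 1 / (4 * M) := by
      calc (1 - x) ^ k₁ ≤ Real.exp (-x) ^ k₁ :=
            pow_le_pow_left₀ (by linarith) (Real.one_sub_le_exp_neg x) _
        _ = Real.exp (-(x * k₁)) := by rw [← Real.exp_nat_mul]; ring_nf
        _ ≤ Real.exp (-Real.log (4 * M)) := by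
            rw [div_le_iff₀ hx0] at hk₁
            apply Real.exp_le_exp.2
            linarith
        _ = 1 / (4 * M) := by rw [Real.exp_neg, Real.exp_log (by positivity), one_div]
    calc r * (1 - x) ^ k₁ ≤ M * (1 / (4 * M)) := by
          apply mul_le_mul hrM e1 (pow_nonneg (by linarith) _) (by linarith)
      _ = 1 / 4 := by field_simp
  · have e1 : 33 / 34 * y ≤ Real.log (1 + y) := by
      refine le_trans ?_ (Real.one_sub_inv_le_log_of_pos (by linarith))
      rw [show 1 - (1 + y)⁻¹ = y / (1 + y) by field_simp; ring, le_div_iff₀ (by linarith)]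
      calc 33 / 34 * y * (1 + y) = y * (33 / 34 * (1 + y)) := by ring
        _ ≤ y * 1 := by gcongr; linarith
        _ = y := mul_one y
    have e2 : 1 / μ₀ ≤ (1 + y) ^ k₂ := by
      calc 1 / μ₀ = Real.exp (-Real.log μ₀) := by rw [Real.exp_neg, Real.exp_log hμ₀0, one_div]
        _ ≤ Real.exp (k₂ * Real.log (1 + y)) := by
            rw [div_le_iff₀ (by positivity)] at hk₂
            apply Real.exp_le_exp.2
            exact hk₂.trans (by gcongr)
        _ = (1 + y) ^ k₂ := by rw [Real.exp_nat_mul, Real.exp_log (by linarith)]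
    calc (1 : ℝ) / 4 ≤ 19 / 20 * μ₀ * (1 / μ₀) := by field_simp; norm_num
      _ ≤ 19 / 20 * μ₀ * (1 + y) ^ k₂ := by gcongr
  · set k₃ := K - (k₁ + k₂) with hk₃
    have hk₃' : 8 * (-Real.log ε) / η ≤ k₃ := by
      rw [hk₃, Nat.cast_sub hkle]
      push_cast
      linarith
    rw [div_le_iff₀ hη] at hk₃'
    have e1 : ((1 - η / 16) ^ 2) ^ k₃ ≤ ε := by
      have hη16 : 0 ≤ 1 - η / 16 := by linarith
      calc ((1 - η / 16) ^ 2) ^ k₃ ≤ (Real.exp (-(η / 16)) ^ 2) ^ k₃ := by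
            gcongr
            exact Real.one_sub_le_exp_neg _
        _ = Real.exp (-(k₃ * η / 8)) := by
            rw [← Real.exp_nat_mul, ← Real.exp_nat_mul]
            push_cast
            ring_nf
        _ ≤ Real.exp (Real.log ε) := by
            apply Real.exp_le_exp.2
            linarith
        _ = ε := Real.exp_log hε0
    linarith

/-- The step size assumption of the theorem in the form in which it is used. -/
lemma step_size_bound {m : ℕ} {η ρ r ε L M c : ℝ} (hρ : 0 < ρ) (hρ5 : ρ ≤ 1 / 5)
    (hε0 : 0 < ε) (hε1 : ε ≤ 1) (hM : M = max 1 r) (hc : c = max 1 (3 / 2 * r))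
    (hL : L = Real.log (15 * ((m + 2 : ℕ) : ℝ) * M / (ρ * ε)))
    (hle : η ≤ ρ ^ 5 * ε / (((m + 2 : ℕ) : ℝ) ^ ((17 : ℝ) / 2) *
      Real.exp (7 * ((m + 2 : ℕ) : ℝ) + 6) *
        M ^ ((11 * ((m + 2 : ℕ) : ℝ) - 5) / 2)) / L ^ 2) :
    (m + 2) * L * η ≤ 1 / 10 ^ 6 * (ρ / c ^ (m + 2)) ^ 2 := by
  have hM1 : 1 ≤ M := hM ▸ le_max_left _ _
  have hc1 : 1 ≤ c := hc ▸ le_max_left _ _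
  have hcM : c ≤ 3 / 2 * M := by
    have hrM : r ≤ M := hM ▸ le_max_right _ _
    rw [hc]
    apply max_le <;> linarith
  have hNcast : ((m + 2 : ℕ) : ℝ) = (m + 2 : ℝ) := by push_cast; rfl
  have hN2 : (2 : ℝ) ≤ ((m + 2 : ℕ) : ℝ) := by
    rw [hNcast]; linarith [(Nat.cast_nonneg m : (0 : ℝ) ≤ m)]
  rw [← hNcast]
  have hLb := log_bounds hN2 hM1 hρ hε0
  rw [← hL] at hLb
  have hlM : 0 ≤ Real.log M := Real.log_nonneg hM1
  have hlρ : Real.log ρ ≤ 0 := Real.log_nonpos hρ.le (by linarith)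
  have hlε : Real.log ε ≤ 0 := Real.log_nonpos hε0.le hε1
  have hL1 : 1 ≤ L := by linarith
  set N : ℝ := ((m + 2 : ℕ) : ℝ) with hN
  have h1 : N ≤ N ^ ((17 : ℝ) / 2) := by
    calc N = N ^ (1 : ℝ) := (Real.rpow_one N).symm
      _ ≤ _ := Real.rpow_le_rpow_of_exponent_le (by linarith) (by norm_num)
  have h2 : M ^ (2 * (m + 2)) ≤ M ^ ((11 * N - 5) / 2) := by
    rw [← Real.rpow_natCast M (2 * (m + 2))]
    apply Real.rpow_le_rpow_of_exponent_le hM1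
    push_cast [hN] at hN2 ⊢
    linarith
  have h3 : 10 ^ 6 * (9 / 4) ^ (m + 2) ≤ Real.exp (7 * N + 6) := by
    have e1 : Real.exp (7 * N + 6) = Real.exp (6 * N + 6) * Real.exp 1 ^ (m + 2) := by
      rw [← Real.exp_nat_mul, ← Real.exp_add]
      congr 1
      rw [← hN]; ring
    have e2 : (9 / 4 : ℝ) ≤ Real.exp 1 := by linarith [Real.exp_one_gt_d9]
    have e3 : (10 : ℝ) ^ 6 ≤ Real.exp (6 * N + 6) := by
      calc (10 : ℝ) ^ 6 ≤ (9 / 4) ^ 18 := by norm_num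
        _ ≤ Real.exp 1 ^ 18 := by gcongr
        _ = Real.exp 18 := by rw [← Real.exp_nat_mul]; norm_num
        _ ≤ _ := Real.exp_le_exp.2 (by linarith)
    rw [e1]
    gcongr
  have h4 : c ^ (2 * (m + 2)) ≤ (9 / 4) ^ (m + 2) * M ^ (2 * (m + 2)) := by
    calc c ^ (2 * (m + 2)) ≤ (3 / 2 * M) ^ (2 * (m + 2)) := by gcongr
      _ = _ := by rw [mul_pow, pow_mul (3 / 2 : ℝ)]; norm_num
  have h5 : ρ ^ 5 * ε ≤ ρ ^ 2 := by
    have : ρ ^ 5 ≤ ρ ^ 2 := pow_le_pow_of_le_one hρ.le (by linarith) (by norm_num)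
    calc ρ ^ 5 * ε ≤ ρ ^ 2 * 1 := by gcongr
      _ = ρ ^ 2 := mul_one _
  have h6 : N * (10 ^ 6 * c ^ (2 * (m + 2))) ≤
      N ^ ((17 : ℝ) / 2) * Real.exp (7 * N + 6) * M ^ ((11 * N - 5) / 2) := by
    calc N * (10 ^ 6 * c ^ (2 * (m + 2)))
        ≤ N * (10 ^ 6 * ((9 / 4) ^ (m + 2) * M ^ (2 * (m + 2)))) := by gcongr
      _ = N * (10 ^ 6 * (9 / 4) ^ (m + 2)) * M ^ (2 * (m + 2)) := by ring
      _ ≤ _ := by gcongr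
  have hc0 : 0 < c := by linarith
  have hN0 : 0 < N := by linarith
  have hL0 : 0 < L := by linarith
  calc N * L * η ≤ N * L * (ρ ^ 2 / (N * (10 ^ 6 * c ^ (2 * (m + 2)))) / L ^ 2) := by
        apply mul_le_mul_of_nonneg_left _ (by positivity)
        refine hle.trans ?_
        gcongr
    _ = 1 / 10 ^ 6 * (ρ / c ^ (m + 2)) ^ 2 * (1 / L) := by
        rw [mul_comm 2 (m + 2), pow_mul]
        field_simp
    _ ≤ 1 / 10 ^ 6 * (ρ / c ^ (m + 2)) ^ 2 * 1 := by
        gcongr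
        rw [div_le_one hL0]; exact hL1
    _ = _ := mul_one _

/-- Convergence of the scalar dynamics from a balanced initial state. -/
lemma half_residual_le {m K : ℕ} {η s ν r ε : ℝ} {a z X : ℕ → ℝ}
    (hst : ∀ j, ScalarStep m η (a j) (z j) (X j) (a (j + 1)) (z (j + 1)) (X (j + 1)))
    (ha0 : a 0 = s) (hz0 : z 0 = ν * s) (hX0 : X 0 = s ^ 2) (hη : 0 < η) (hs : 0 < s)
    (hs5 : s ^ (m + 2) ≤ 1 / 5) (hν0 : -1 < ν) (hν1 : ν ≤ 1) (hr : r = (1 - ν) / (1 + ν))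
    (hε0 : 0 < ε) (hε1 : ε ≤ 1)
    (hle : η ≤ (s ^ (m + 2)) ^ 5 * ε / (((m + 2 : ℕ) : ℝ) ^ ((17 : ℝ) / 2) *
      Real.exp (7 * ((m + 2 : ℕ) : ℝ) + 6) *
        (max 1 r) ^ ((11 * ((m + 2 : ℕ) : ℝ) - 5) / 2)) /
        Real.log (15 * ((m + 2 : ℕ) : ℝ) * max 1 r / (s ^ (m + 2) * ε)) ^ 2)
    (hK : K = ⌊2 * ((m + 2 : ℕ) : ℝ) * (max 1 (3 / 2 * r)) ^ (m + 2) / (s ^ (m + 2) * η) *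
      Real.log (15 * ((m + 2 : ℕ) : ℝ) * max 1 r / (s ^ (m + 2) * ε)) + 1⌋₊) :
    1 / 2 * scalarResidual m (a K) (z K) (X K) ≤ ε := by
  have hr1 : r * (1 + ν) = 1 - ν := by
    rw [hr]; exact div_mul_cancel₀ _ (by linarith)
  have hr0 : 0 ≤ r := by rw [hr]; exact div_nonneg (by linarith) (by linarith)
  have hs1 : s ≤ 1 := by
    by_contra! h
    linarith [one_le_pow₀ h.le (n := m + 2)]
  have hc1 : (1 : ℝ) ≤ max 1 (3 / 2 * r) := le_max_left _ _
  have hsmall := step_size_bound (by positivity) hs5 hε0 hε1 rfl rfl rfl hle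
  rw [← div_pow] at hsmall
  obtain ⟨hηm, k₁, k₂, k₃, hk, hb, hk₁, hk₂, hk₃⟩ :=
    exists_phase_lengths hη hs hs5 hε0 hε1 rfl rfl rfl rfl hsmall hK
  rw [hk] at hb ⊢
  refine le_trans ?_ hk₃
  gcongr
  have hpow : (s / max 1 (3 / 2 * r)) ^ (m + 2) ≤ s ^ (m + 2) :=
    pow_le_pow_left₀ (by positivity) (div_le_self hs.le hc1) _
  have hρ0 : 0 < (s / max 1 (3 / 2 * r)) ^ (m + 2) := by positivity
  refine residual_trajectory hst hη hηm hr0 hs hs1 hs5 hc1 (le_max_right _ _) rfl ?_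
    (by rw [hX0, ha0]) ?_ hb hk₁ hk₂
  · rw [ha0, hz0, hX0]
    refine ⟨⟨hs, hs1, by linarith, le_rfl, by linarith⟩, ?_, ?_⟩
    · have e : scalarResidual m s (ν * s) (s ^ 2) =
          (s ^ (m + 2)) ^ 2 - 2 * s ^ (m + 2) * ν + 1 := by
        rw [scalarResidual]; ring
      have h0 : 0 ≤ s ^ (m + 2) := by positivity
      rw [e]
      nlinarith
    · by_cases h : ν < 1 / 5
      · refine Or.inl ⟨hs5, by nlinarith, by nlinarith, le_of_eq ?_⟩
        linear_combination (-s ^ 2) * hr1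
      · right
        rw [not_lt] at h
        gcongr
  · rw [ha0, hz0]
    apply le_of_eq
    linear_combination (-s) * hr1

section network

variable {n : ℕ} {dims : ℕ → ℕ}

lemma castId_self (p : ℕ) : castId p p = 1 := by
  ext i j
  simp [castId, Matrix.one_apply, Fin.ext_iff]

lemma segProd_self (W : WeightFam n dims) (a : ℕ) : segProd dims W a a = 1 := by
  cases a with
  | zero => exact castId_self _
  | succ a => rw [segProd, if_pos rfl, castId_self]

lemma segProd_succ (W : WeightFam n dims) {a b : ℕ} (hab : a ≤ b) (hb : b < n) :
    segProd dims W a (b + 1) = W ⟨b, hb⟩ * segProd dims W a b := by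
  rw [segProd, if_neg (by omega), dif_pos hb]

lemma segProd_eq_mul (W : WeightFam n dims) {a b : ℕ} (hab : a < b) (hb : b ≤ n) :
    segProd dims W a b = segProd dims W (a + 1) b * W ⟨a, by omega⟩ := by
  induction b, hab using Nat.le_induction with
  | base => rw [segProd_succ W le_rfl (by omega), segProd_self, segProd_self, Matrix.mul_one, Matrix.one_mul]
  | succ b hab ih =>
    rw [segProd_succ W (by omega) (by omega), ih (by omega), segProd_succ W hab (by omega),
      Matrix.mul_assoc]

/-- A matrix whose Gram matrix of rows has rank one has rank one. -/
lemma eq_vecMulVec_of_mul_transpose {p q : ℕ} {W : Matrix (Fin p) (Fin q) ℝ} {e : Fin p → ℝ}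
    {c : ℝ} (he : e ⬝ᵥ e = 1) (hW : W * Wᵀ = c • vecMulVec e e) : W = vecMulVec e (e ᵥ* W) := by
  have h0 : (W - vecMulVec e (e ᵥ* W)) * (W - vecMulVec e (e ᵥ* W))ᵀ = 0 := by
    have h1 : vecMulVec e (e ᵥ* W) = vecMulVec e e * W := (vecMulVec_mul e e W).symm
    have h2 : vecMulVec e e * vecMulVec e e = vecMulVec e e := by
      rw [vecMulVec_mul_vecMulVec, he, one_smul]
    rw [h1, transpose_sub, transpose_mul, transpose_vecMulVec, Matrix.sub_mul, Matrix.mul_sub,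
      Matrix.mul_sub, hW, ← Matrix.mul_assoc W, hW, Matrix.mul_assoc _ W, hW,
      Matrix.mul_assoc _ W, ← Matrix.mul_assoc W, hW]
    simp [h2]
  rw [← conjTranspose_eq_transpose_of_trivial, Matrix.self_mul_conjTranspose_eq_zero] at h0
  exact sub_eq_zero.1 h0

/-- In a balanced network with scalar output and nonzero end-to-end matrix, all layers have rank
one, the same norm, and matching singular vectors. -/
lemma IsBalanced.exists_rank_one {W : WeightFam n dims} (hbal : IsBalanced dims W)
    (hdn : dims n = 1) (hn : 1 ≤ n) (h0 : segProd dims W 0 n ≠ 0) :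
    ∃ s : ℝ, 0 < s ∧ ∃ u : ∀ j, Fin (dims j) → ℝ, (∀ j ≤ n, u j ⬝ᵥ u j = 1) ∧
      ∀ j (hj : j < n), W ⟨j, hj⟩ = s • vecMulVec (u (j + 1)) (u j) := by
  obtain ⟨k, rfl⟩ : ∃ k, n = k + 1 := ⟨n - 1, by omega⟩
  have hk : k < k + 1 := by omega
  have : Unique (Fin (dims (k + 1))) := by rw [hdn]; infer_instance
  set t : ℝ := (W ⟨k, hk⟩ * (W ⟨k, hk⟩)ᵀ) default default with ht
  have hWk : W ⟨k, hk⟩ ≠ 0 := by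
    intro h
    rw [segProd_succ W (by omega) (by omega), h, Matrix.zero_mul] at h0
    exact h0 rfl
  have ht0 : 0 < t := by
    have h1 : 0 ≤ t := by
      rw [ht, Matrix.mul_apply]
      exact Finset.sum_nonneg fun i _ => mul_self_nonneg _
    refine lt_of_le_of_ne h1 fun h => hWk ?_
    apply Matrix.self_mul_conjTranspose_eq_zero.1
    rw [conjTranspose_eq_transpose_of_trivial]
    ext i j
    rw [Unique.eq_default i, Unique.eq_default j]
    exact h.symm
  set s := Real.sqrt t
  have hs : 0 < s := Real.sqrt_pos.2 ht0
  have hst : s ^ 2 = t := Real.sq_sqrt ht0.le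
  set u : ∀ j, Fin (dims j) → ℝ :=
    fun j => (s ^ (k + 1 - j))⁻¹ • segProd dims W j (k + 1) default with hu
  have hstep : ∀ j (hj : j < k + 1), u (j + 1) ᵥ* W ⟨j, hj⟩ = s • u j := by
    intro j hj
    have e1 : segProd dims W j (k + 1) default =
        segProd dims W (j + 1) (k + 1) default ᵥ* W ⟨j, hj⟩ := by
      rw [segProd_eq_mul W hj le_rfl]
      rfl
    have e2 : k + 1 - j = (k + 1 - (j + 1)) + 1 := by omega
    simp only [hu]
    rw [e1, e2, smul_vecMul, smul_smul, pow_succ]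
    congr 1
    field_simp
  have hun : u (k + 1) ⬝ᵥ u (k + 1) = 1 := by
    simp only [hu]
    rw [segProd_self]
    simp [dotProduct]
  have hrank : ∀ j (hj : j < k + 1), u (j + 1) ⬝ᵥ u (j + 1) = 1 →
      W ⟨j, hj⟩ * (W ⟨j, hj⟩)ᵀ = s ^ 2 • vecMulVec (u (j + 1)) (u (j + 1)) →
      u j ⬝ᵥ u j = 1 ∧ W ⟨j, hj⟩ = s • vecMulVec (u (j + 1)) (u j) := by
    intro j hj h1 h2
    have h3 := eq_vecMulVec_of_mul_transpose h1 h2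
    rw [hstep j hj, vecMulVec_smul] at h3
    refine ⟨?_, h3⟩
    have hU : vecMulVec (u (j + 1)) (u (j + 1)) ≠ 0 := by
      have : u (j + 1) ≠ 0 := fun h => by simp [h] at h1
      exact vecMulVec_ne_zero this this
    rw [h3, transpose_smul, transpose_vecMulVec, Matrix.smul_mul, Matrix.mul_smul,
      vecMulVec_mul_vecMulVec, vecMulVec_smul, smul_smul, smul_smul] at h2
    have h4 := smul_left_injective ℝ hU h2
    have h5 : 0 < s ^ 2 := by positivity
    exact mul_left_cancel₀ h5.ne' (by linarith)
  have key : ∀ i j, j + i = k → u (j + 1) ⬝ᵥ u (j + 1) = 1 ∧ ∀ hj : j < k + 1,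
      W ⟨j, hj⟩ * (W ⟨j, hj⟩)ᵀ = s ^ 2 • vecMulVec (u (j + 1)) (u (j + 1)) := by
    intro i
    induction i with
    | zero =>
      rintro j rfl
      refine ⟨hun, fun hj => ?_⟩
      have h1 := hun
      simp only [dotProduct, Fintype.sum_unique] at h1
      ext p q
      rw [hst, Unique.eq_default p, Unique.eq_default q, Matrix.smul_apply, vecMulVec_apply]
      simp only [Nat.add_zero] at h1 ⊢
      rw [h1, smul_eq_mul, mul_one]
      rfl
    | succ i ih =>
      intro j hj
      obtain ⟨h1, h2⟩ := ih (j + 1) (by omega)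
      obtain ⟨h3, h4⟩ := hrank (j + 1) (by omega) h1 (h2 (by omega))
      refine ⟨h3, fun hj' => ?_⟩
      rw [← hbal j (by omega), h4, transpose_smul, transpose_vecMulVec, Matrix.smul_mul,
        Matrix.mul_smul, vecMulVec_mul_vecMulVec, h1, one_smul, smul_smul, sq]
  refine ⟨s, hs, u, fun j hj => ?_, fun j hj => ?_⟩
  · rcases hj.eq_or_lt with rfl | hj
    · exact hun
    · obtain ⟨h1, h2⟩ := key (k - j) j (by omega)
      exact (hrank j hj h1 (h2 hj)).1
  · obtain ⟨h1, h2⟩ := key (k - j) j (by omega)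
    exact (hrank j hj h1 (h2 hj)).2

end network

section flow

variable {m d : ℕ} {dims : ℕ → ℕ}

/-- Weights of the form `W_0 = u_1 xᵀ`, `W_j = a u_{j+1} u_jᵀ` for `j ≥ 1`. -/
structure Aligned (u : ∀ j, Fin (dims j) → ℝ) (a : ℝ) (x : Fin (dims 0) → ℝ)
    (W : WeightFam (m + 2) dims) : Prop where
  first : W ⟨0, by omega⟩ = vecMulVec (u 1) x
  rest : ∀ j (h : j + 1 < m + 2), W ⟨j + 1, h⟩ = a • vecMulVec (u (j + 2)) (u (j + 1))

lemma Aligned.segProd_eq {u : ∀ j, Fin (dims j) → ℝ} {a : ℝ} {x : Fin (dims 0) → ℝ}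
    {W : WeightFam (m + 2) dims} (hW : Aligned u a x W)
    (hu : ∀ j ≤ m + 2, u j ⬝ᵥ u j = 1) {b : ℕ} (hb : b < m + 2) :
    segProd dims W 0 (b + 1) = a ^ b • vecMulVec (u (b + 1)) x := by
  induction b with
  | zero =>
    rw [segProd_succ W le_rfl hb, segProd_self, Matrix.mul_one, hW.first, pow_zero, one_smul]
  | succ b ih =>
    rw [segProd_succ W (by omega) hb, ih (by omega), hW.rest b hb, Matrix.smul_mul,
      Matrix.mul_smul, vecMulVec_mul_vecMulVec, hu (b + 1) (by omega), one_smul, smul_smul,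
      pow_succ']

/-- The entries of a layer as continuous linear functionals of the parameter vector. -/
def entry {n : ℕ} (arr : EuclideanSpace ℝ (Fin d) →ₗ[ℝ] WeightFam n dims) (j : Fin n)
    (p : Fin (dims (j.val + 1))) (q : Fin (dims j.val)) : EuclideanSpace ℝ (Fin d) →L[ℝ] ℝ :=
  LinearMap.toContinuousLinearMap
    { toFun := fun θ => arr θ j p q
      map_add' := fun θ θ' => by simp
      map_smul' := fun c θ => by simp }

lemma entry_apply {n : ℕ} (arr : EuclideanSpace ℝ (Fin d) →ₗ[ℝ] WeightFam n dims) (j : Fin n)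
    (p : Fin (dims (j.val + 1))) (q : Fin (dims j.val)) (θ : EuclideanSpace ℝ (Fin d)) :
    entry arr j p q θ = arr θ j p q := rfl

/-- The component of layer `j + 1` along `u_{j+2} u_{j+1}ᵀ`. -/
def alignedPart (u : ∀ j, Fin (dims j) → ℝ) (V : WeightFam (m + 2) dims) (j : ℕ) : ℝ :=
  if h : j + 1 < m + 2 then u (j + 2) ⬝ᵥ V ⟨j + 1, h⟩ *ᵥ u (j + 1) else 0

/-- The derivative of the partial products at aligned weights. -/
lemma exists_hasFDerivAt_segProd (arr : EuclideanSpace ℝ (Fin d) →ₗ[ℝ] WeightFam (m + 2) dims)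
    {u : ∀ j, Fin (dims j) → ℝ} (hu : ∀ j ≤ m + 2, u j ⬝ᵥ u j = 1) {a : ℝ}
    {x : Fin (dims 0) → ℝ} {θ : EuclideanSpace ℝ (Fin d)} (hW : Aligned u a x (arr θ))
    {b : ℕ} (hb : b < m + 2) :
    ∃ D : Fin (dims (b + 1)) → Fin (dims 0) → EuclideanSpace ℝ (Fin d) →L[ℝ] ℝ,
      (∀ p q, HasFDerivAt (fun θ' => segProd dims (arr θ') 0 (b + 1) p q) (D p q) θ) ∧
      ∀ v q, ∑ p, u (b + 1) p * D p q v =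
        a ^ b * (u 1 ᵥ* arr v ⟨0, by omega⟩) q +
          ∑ j ∈ Finset.range b, a ^ (b - 1) * alignedPart u (arr v) j * x q := by
  induction b with
  | zero =>
    refine ⟨fun p q => entry arr ⟨0, hb⟩ p q, fun p q => ?_, fun v q => ?_⟩
    · refine (entry arr ⟨0, hb⟩ p q).hasFDerivAt.congr_of_eventuallyEq (.of_forall fun θ' => ?_)
      have h : segProd dims (arr θ') 0 1 = arr θ' ⟨0, hb⟩ := by
        rw [segProd_succ _ le_rfl hb, segProd_self, Matrix.mul_one]
      exact congrFun (congrFun h p) q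
    · simp only [pow_zero, one_mul, Finset.range_zero, Finset.sum_empty, add_zero]
      rfl
  | succ b ih =>
    obtain ⟨D, hD, hDv⟩ := ih (by omega)
    refine ⟨fun p q => ∑ i, (arr θ ⟨b + 1, hb⟩ p i • D i q +
      segProd dims (arr θ) 0 (b + 1) i q • entry arr ⟨b + 1, hb⟩ p i), fun p q => ?_,
      fun v q => ?_⟩
    · have h1 : HasFDerivAt (fun θ' => ∑ i, entry arr ⟨b + 1, hb⟩ p i θ' *
          segProd dims (arr θ') 0 (b + 1) i q) (∑ i, (arr θ ⟨b + 1, hb⟩ p i • D i q +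
          segProd dims (arr θ) 0 (b + 1) i q • entry arr ⟨b + 1, hb⟩ p i)) θ :=
        HasFDerivAt.fun_sum fun i _ => (entry arr ⟨b + 1, hb⟩ p i).hasFDerivAt.mul (hD i q)
      refine h1.congr_of_eventuallyEq (.of_forall fun θ' => ?_)
      have h := segProd_succ (arr θ') (Nat.zero_le (b + 1)) hb
      exact congrFun (congrFun h p) q
    · have hub := hu (b + 2) (by omega)
      have e1 : ∀ p i, arr θ ⟨b + 1, hb⟩ p i = a * (u (b + 2) p * u (b + 1) i) := fun p i => by
        rw [hW.rest b hb]; rfl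
      have e2 : ∀ i, segProd dims (arr θ) 0 (b + 1) i q = a ^ b * (u (b + 1) i * x q) := fun i => by
        rw [hW.segProd_eq hu (by omega)]; rfl
      have e3 : alignedPart u (arr v) b =
          ∑ p, ∑ i, u (b + 2) p * (arr v ⟨b + 1, hb⟩ p i * u (b + 1) i) := by
        rw [alignedPart, dif_pos hb]
        simp only [dotProduct, mulVec, Finset.mul_sum]
      have e4 : ∑ p, u (b + 1 + 1) p * (∑ i, (arr θ ⟨b + 1, hb⟩ p i • D i q +
          segProd dims (arr θ) 0 (b + 1) i q • entry arr ⟨b + 1, hb⟩ p i)) v =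
          a * ((u (b + 2) ⬝ᵥ u (b + 2)) * ∑ i, u (b + 1) i * D i q v) +
            a ^ b * alignedPart u (arr v) b * x q := by
        rw [e3]
        simp only [e1, e2, _root_.sum_apply, _root_.add_apply,
          _root_.smul_apply, entry_apply, smul_eq_mul, dotProduct, Finset.mul_sum,
          Finset.sum_mul, Finset.sum_add_distrib, mul_add]
        congr 1
        · rw [Finset.sum_comm]
          refine Finset.sum_congr rfl fun i _ => Finset.sum_congr rfl fun p _ => ?_
          ring
        · refine Finset.sum_congr rfl fun p _ => Finset.sum_congr rfl fun i _ => ?_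
          ring
      have e5 : a * ∑ j ∈ Finset.range b, a ^ (b - 1) * alignedPart u (arr v) j * x q =
          ∑ j ∈ Finset.range b, a ^ b * alignedPart u (arr v) j * x q := by
        rw [Finset.mul_sum]
        refine Finset.sum_congr rfl fun j hj => ?_
        obtain ⟨c, rfl⟩ := Nat.exists_eq_succ_of_ne_zero (n := b) (by rintro rfl; simp at hj)
        simp only [Nat.succ_eq_add_one, Nat.add_sub_cancel]
        ring
      rw [e4, hub, one_mul, hDv, Finset.sum_range_succ, mul_add, Nat.add_sub_cancel, e5]
      ring

end flow

lemma frobNorm_sq {p q : ℕ} (M : Matrix (Fin p) (Fin q) ℝ) :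
    frobNorm M ^ 2 = ∑ i, ∑ j, M i j ^ 2 :=
  Real.sq_sqrt (Finset.sum_nonneg fun _ _ => Finset.sum_nonneg fun _ _ => sq_nonneg _)

lemma frobNorm_vecMulVec_sq {p q : ℕ} (v : Fin p → ℝ) (w : Fin q → ℝ) :
    frobNorm (vecMulVec v w) ^ 2 = (v ⬝ᵥ v) * (w ⬝ᵥ w) := by
  rw [frobNorm_sq, dotProduct, dotProduct, Finset.sum_mul_sum]
  refine Finset.sum_congr rfl fun i _ => Finset.sum_congr rfl fun j _ => ?_
  rw [vecMulVec_apply]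
  ring

section flow

variable {m d : ℕ} {dims : ℕ → ℕ}

/-- The gradient at aligned weights, with residual `r`. -/
def alignedGrad (u : ∀ j, Fin (dims j) → ℝ) (a : ℝ) (x r : Fin (dims 0) → ℝ) :
    WeightFam (m + 2) dims
  | ⟨0, _⟩ => a ^ (m + 1) • vecMulVec (u 1) r
  | ⟨j + 1, _⟩ => (a ^ m * (r ⬝ᵥ x)) • vecMulVec (u (j + 2)) (u (j + 1))

lemma sum_alignedGrad_mul (u : ∀ j, Fin (dims j) → ℝ) (a : ℝ) (x r : Fin (dims 0) → ℝ)
    (V : WeightFam (m + 2) dims) :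
    ∑ j : Fin (m + 2), ∑ p : Fin (dims (j.val + 1)), ∑ q : Fin (dims j.val),
        alignedGrad u a x r j p q * V j p q =
      a ^ (m + 1) * (r ⬝ᵥ (u 1 ᵥ* V ⟨0, by omega⟩)) +
        ∑ j ∈ Finset.range (m + 1), a ^ m * (r ⬝ᵥ x) * alignedPart u V j := by
  rw [Fin.sum_univ_succ, ← Fin.sum_univ_eq_sum_range
    (fun j => a ^ m * (r ⬝ᵥ x) * alignedPart u V j)]
  congr 1
  · simp only [dotProduct, vecMul, Finset.mul_sum]
    rw [Finset.sum_comm]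
    refine Finset.sum_congr rfl fun q _ => Finset.sum_congr rfl fun p _ => ?_
    change a ^ (m + 1) * (u 1 p * r q) * V ⟨0, by omega⟩ p q = _
    ring
  · refine Finset.sum_congr rfl fun j _ => ?_
    rw [alignedPart, dif_pos (by omega)]
    change ∑ p : Fin (dims (j + 2)), ∑ q : Fin (dims (j + 1)),
      (a ^ m * (r ⬝ᵥ x)) * (u (j + 2) p * u (j + 1) q) * V ⟨j + 1, by omega⟩ p q = _
    generalize a ^ m * (r ⬝ᵥ x) = c
    rw [dotProduct, Finset.mul_sum]
    refine Finset.sum_congr rfl fun p _ => ?_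
    rw [mulVec, dotProduct, Finset.mul_sum, Finset.mul_sum]
    refine Finset.sum_congr rfl fun q _ => ?_
    ring

lemma hasGradientAt_of_aligned (arr : EuclideanSpace ℝ (Fin d) →ₗ[ℝ] WeightFam (m + 2) dims)
    (hinner : ∀ u v : EuclideanSpace ℝ (Fin d), ⟪u, v⟫ =
      ∑ j : Fin (m + 2), ∑ p : Fin (dims (j.val + 1)), ∑ q : Fin (dims j.val),
        arr u j p q * arr v j p q)
    {f : EuclideanSpace ℝ (Fin d) → ℝ} {Lyx : Matrix (Fin (dims (m + 2))) (Fin (dims 0)) ℝ} {C : ℝ}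
    (hf : ∀ θ', f θ' = 1 / 2 * frobNorm (segProd dims (arr θ') 0 (m + 2) - Lyx) ^ 2 + C)
    {u : ∀ j, Fin (dims j) → ℝ} (hu : ∀ j ≤ m + 2, u j ⬝ᵥ u j = 1)
    {l : Fin (dims 0) → ℝ} (hl : Lyx = vecMulVec (u (m + 2)) l) {a : ℝ}
    {x : Fin (dims 0) → ℝ} {θ g : EuclideanSpace ℝ (Fin d)} (hW : Aligned u a x (arr θ))
    (hg : arr g = alignedGrad u a x (a ^ (m + 1) • x - l)) : HasGradientAt f g θ := by
  obtain ⟨D, hD, hDv⟩ := exists_hasFDerivAt_segProd arr hu hW (b := m + 1) (by omega)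
  set r := a ^ (m + 1) • x - l with hr
  have hres : segProd dims (arr θ) 0 (m + 2) - Lyx = vecMulVec (u (m + 2)) r := by
    rw [hW.segProd_eq hu (b := m + 1) (by omega), hl, hr, vecMulVec_sub, vecMulVec_smul]
  have hf' : f = fun θ' => ∑ p, ∑ q, 1 / 2 *
      (segProd dims (arr θ') 0 (m + 2) p q - Lyx p q) ^ 2 + C := by
    ext θ'
    rw [hf, frobNorm_sq]
    simp only [Finset.mul_sum]
    rfl
  have h1 : HasFDerivAt f (∑ p, ∑ q, (segProd dims (arr θ) 0 (m + 2) - Lyx) p q • D p q) θ := by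
    rw [hf']
    refine (HasFDerivAt.fun_sum fun p _ => HasFDerivAt.fun_sum fun q _ => ?_).add_const C
    refine ((((hD p q).sub_const (Lyx p q)).pow 2).const_mul (1 / 2)).congr_fderiv ?_
    ext v
    simp only [_root_.smul_apply, smul_eq_mul, Matrix.sub_apply, nsmul_eq_mul]
    norm_num
    ring
  rw [hasGradientAt_iff_hasFDerivAt]
  refine h1.congr_fderiv (ContinuousLinearMap.ext fun v => ?_)
  rw [InnerProductSpace.toDual_apply_apply, hinner, hg, sum_alignedGrad_mul, hres]
  have e1 : (∑ p, ∑ q, vecMulVec (u (m + 2)) r p q • D p q) v =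
      ∑ q, r q * ∑ p, u (m + 2) p * D p q v := by
    simp only [_root_.sum_apply, _root_.smul_apply, smul_eq_mul, vecMulVec_apply, Finset.mul_sum]
    rw [Finset.sum_comm]
    refine Finset.sum_congr rfl fun q _ => Finset.sum_congr rfl fun p _ => ?_
    ring
  rw [e1]
  simp only [hDv, mul_add, Finset.sum_add_distrib, dotProduct, Nat.add_sub_cancel]
  congr 1
  · rw [Finset.mul_sum]
    exact Finset.sum_congr rfl fun q _ => by ring
  · simp only [Finset.mul_sum, Finset.sum_mul]
    rw [Finset.sum_comm]
    exact Finset.sum_congr rfl fun q _ => Finset.sum_congr rfl fun j _ => by ring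

lemma Aligned.gradient_step {arr : EuclideanSpace ℝ (Fin d) →ₗ[ℝ] WeightFam (m + 2) dims}
    {u : ∀ j, Fin (dims j) → ℝ} {a : ℝ} {x r : Fin (dims 0) → ℝ} {θ g : EuclideanSpace ℝ (Fin d)}
    (hW : Aligned u a x (arr θ)) (hg : arr g = alignedGrad u a x r) (η : ℝ) :
    Aligned u (a - η * (a ^ m * (r ⬝ᵥ x))) (x - (η * a ^ (m + 1)) • r) (arr (θ - η • g)) := by
  have h : arr (θ - η • g) = arr θ - η • alignedGrad u a x r := by rw [map_sub, map_smul, hg]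
  constructor
  · rw [h, Pi.sub_apply, Pi.smul_apply, hW.first, vecMulVec_sub, vecMulVec_smul, mul_smul]
    rfl
  · intro j hj
    rw [h, Pi.sub_apply, Pi.smul_apply, hW.rest j hj, sub_smul, mul_smul]
    rfl

end flow

/-- Gradient descent on aligned weights in the coordinates `(a, x)`. -/
def alignedStep {p : ℕ} (m : ℕ) (η : ℝ) (l : Fin p → ℝ) (w : ℝ × (Fin p → ℝ)) :
    ℝ × (Fin p → ℝ) :=
  (w.1 - η * (w.1 ^ m * ((w.1 ^ (m + 1) • w.2 - l) ⬝ᵥ w.2)),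
    w.2 - (η * w.1 ^ (m + 1)) • (w.1 ^ (m + 1) • w.2 - l))

lemma dotProduct_sq_le {p : ℕ} (v w : Fin p → ℝ) : (v ⬝ᵥ w) ^ 2 ≤ (v ⬝ᵥ v) * (w ⬝ᵥ w) := by
  simp only [dotProduct, ← sq]
  exact Finset.sum_mul_sq_le_sq_mul_sq _ _ _

lemma scalarStep_alignedStep {p m : ℕ} {η : ℝ} {l : Fin p → ℝ} (hl : l ⬝ᵥ l = 1)
    (w : ℝ × (Fin p → ℝ)) :
    ScalarStep m η w.1 (w.2 ⬝ᵥ l) (w.2 ⬝ᵥ w.2) (alignedStep m η l w).1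
      ((alignedStep m η l w).2 ⬝ᵥ l) ((alignedStep m η l w).2 ⬝ᵥ (alignedStep m η l w).2) := by
  have hc : l ⬝ᵥ w.2 = w.2 ⬝ᵥ l := dotProduct_comm _ _
  constructor
  · simp only [alignedStep, sub_dotProduct, smul_dotProduct, smul_eq_mul, hc]
    ring
  · simp only [alignedStep, sub_dotProduct, smul_dotProduct, smul_eq_mul, hl]
    ring
  · simp only [alignedStep, sub_dotProduct, smul_dotProduct, smul_eq_mul, dotProduct_sub,
      dotProduct_smul, hl, hc]
    ring
  · simpa [hl] using dotProduct_sq_le w.2 l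

lemma aligned_gdIter {m d : ℕ} {dims : ℕ → ℕ}
    (arr : EuclideanSpace ℝ (Fin d) →ₗ[ℝ] WeightFam (m + 2) dims)
    (harr : Function.Surjective arr)
    (hinner : ∀ u v : EuclideanSpace ℝ (Fin d), ⟪u, v⟫ =
      ∑ j : Fin (m + 2), ∑ p : Fin (dims (j.val + 1)), ∑ q : Fin (dims j.val),
        arr u j p q * arr v j p q)
    {f : EuclideanSpace ℝ (Fin d) → ℝ} {Lyx : Matrix (Fin (dims (m + 2))) (Fin (dims 0)) ℝ} {C : ℝ}
    (hf : ∀ θ', f θ' = 1 / 2 * frobNorm (segProd dims (arr θ') 0 (m + 2) - Lyx) ^ 2 + C)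
    {u : ∀ j, Fin (dims j) → ℝ} (hu : ∀ j ≤ m + 2, u j ⬝ᵥ u j = 1)
    {l : Fin (dims 0) → ℝ} (hl : Lyx = vecMulVec (u (m + 2)) l) {θ : EuclideanSpace ℝ (Fin d)}
    {w : ℝ × (Fin (dims 0) → ℝ)} (hW : Aligned u w.1 w.2 (arr θ)) (η : ℝ) (k : ℕ) :
    Aligned u ((alignedStep m η l)^[k] w).1 ((alignedStep m η l)^[k] w).2
      (arr (gdIter f η θ k)) := by
  induction k with
  | zero => exact hW
  | succ k ih =>
    obtain ⟨g, hg⟩ := harr (alignedGrad u ((alignedStep m η l)^[k] w).1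
      ((alignedStep m η l)^[k] w).2
      (((alignedStep m η l)^[k] w).1 ^ (m + 1) • ((alignedStep m η l)^[k] w).2 - l))
    have h := ih.gradient_step hg η
    rw [← (hasGradientAt_of_aligned arr hinner hf hu hl ih hg).gradient] at h
    rw [Function.iterate_succ_apply']
    exact h

lemma eq_vecMulVec_of_unique {p q : ℕ} (hp : p = 1) {e : Fin p → ℝ} (he : e ⬝ᵥ e = 1)
    (M : Matrix (Fin p) (Fin q) ℝ) : M = vecMulVec e (e ᵥ* M) := by
  subst hp
  ext i j
  simp only [dotProduct, Fintype.sum_unique] at he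
  rw [vecMulVec_apply, vecMul, dotProduct, Fintype.sum_unique, ← mul_assoc, Unique.eq_default i, he,
    one_mul]

/-- Theorem 3 of the paper: gradient descent on the square-loss training
loss of a deep linear network with scalar output, started from a balanced initialization of
small positive norm whose end-to-end matrix is not antiparallel to `Λ_yx`, converges to
`ε'`-optimality within an explicit number of iterations provided the step size is small
enough. -/
theorem deep_linear_gradient_descent_convergence {n d : ℕ} (hn : 2 ≤ n)
    (dims : ℕ → ℕ) (hdn : dims n = 1)
    (Lyx : Matrix (Fin (dims n)) (Fin (dims 0)) ℝ) (hLyx : frobNorm Lyx = 1)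
    (arr : EuclideanSpace ℝ (Fin d) →ₗ[ℝ] WeightFam n dims)
    (harr : Function.Bijective arr)
    (hinner : ∀ u v : EuclideanSpace ℝ (Fin d), ⟪u, v⟫ =
      ∑ j : Fin n, ∑ p : Fin (dims (j.val + 1)), ∑ q : Fin (dims j.val),
        arr u j p q * arr v j p q)
    (f : EuclideanSpace ℝ (Fin d) → ℝ)
    (hf : ∀ θ', f θ' =
      1 / 2 * frobNorm (segProd dims (arr θ') 0 n - Lyx) ^ 2 + sInf (Set.range f))
    (θ0 : EuclideanSpace ℝ (Fin d)) (hbal : IsBalanced dims (arr θ0))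
    (W0 : Matrix (Fin (dims n)) (Fin (dims 0)) ℝ) (hW0 : W0 = segProd dims (arr θ0) 0 n)
    (hW0pos : 0 < frobNorm W0) (hW0small : frobNorm W0 ≤ 0.2)
    (ν : ℝ) (hν : ν = Matrix.trace (Lyxᵀ * W0) / (frobNorm Lyx * frobNorm W0))
    (hν1 : ν ≠ -1)
    (ε' : ℝ) (hε' : 0 < ε') (η : ℝ) (hη0 : 0 < η)
    (hη : η ≤ frobNorm W0 ^ 5 * min 1 ε' /
        ((n : ℝ) ^ ((17 : ℝ) / 2) * Real.exp (7 * (n : ℝ) + 6) *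
          (max 1 ((1 - ν) / (1 + ν))) ^ ((11 * (n : ℝ) - 5) / 2)) /
        Real.log (15 * (n : ℝ) * max 1 ((1 - ν) / (1 + ν)) /
          (frobNorm W0 * min 1 ε')) ^ 2)
    (k : ℕ)
    (hk : k = ⌊2 * (n : ℝ) * (max 1 (3 / 2 * ((1 - ν) / (1 + ν)))) ^ n /
        (frobNorm W0 * η) *
        Real.log (15 * (n : ℝ) * max 1 ((1 - ν) / (1 + ν)) /
          (frobNorm W0 * min 1 ε')) + 1⌋₊) :
    f (gdIter f η θ0 k) - sInf (Set.range f) ≤ ε' := by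
  obtain ⟨m, rfl⟩ : ∃ m, n = m + 2 := ⟨n - 2, by omega⟩
  have hW0ne : segProd dims (arr θ0) 0 (m + 2) ≠ 0 := by
    intro h
    rw [hW0, h] at hW0pos
    simp [frobNorm] at hW0pos
  obtain ⟨s, hs, u, hu, hWj⟩ := hbal.exists_rank_one hdn (by omega) hW0ne
  have hun := hu (m + 2) le_rfl
  have hu0 := hu 0 (by omega)
  have hal : Aligned u s (s • u 0) (arr θ0) :=
    ⟨by rw [hWj, vecMulVec_smul], fun j hj => hWj (j + 1) hj⟩
  set l := u (m + 2) ᵥ* Lyx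
  have hl : Lyx = vecMulVec (u (m + 2)) l := eq_vecMulVec_of_unique hdn hun Lyx
  have hll : l ⬝ᵥ l = 1 := by
    have h := frobNorm_vecMulVec_sq (u (m + 2)) l
    rw [← hl, hLyx, hun] at h
    linarith
  have hW0' : W0 = vecMulVec (u (m + 2)) (s ^ (m + 2) • u 0) := by
    rw [hW0, hal.segProd_eq hu (b := m + 1) (by omega), ← vecMulVec_smul, smul_smul, ← pow_succ]
  have hρ : frobNorm W0 = s ^ (m + 2) := by
    have h := frobNorm_vecMulVec_sq (u (m + 2)) (s ^ (m + 2) • u 0)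
    rw [← hW0', hun, smul_dotProduct, dotProduct_smul, hu0, smul_eq_mul, smul_eq_mul] at h
    exact (pow_left_inj₀ hW0pos.le (by positivity) two_ne_zero).1 (by linarith)
  have hνu : ν = u 0 ⬝ᵥ l := by
    rw [hν, hLyx, one_mul, hρ, hW0', hl, transpose_vecMulVec, vecMulVec_mul_vecMulVec, hun,
      one_smul, trace_vecMulVec, dotProduct_smul, smul_eq_mul, mul_div_cancel_left₀ _ (by positivity),
      dotProduct_comm]
  have hν2 : ν ^ 2 ≤ 1 := by
    have h := dotProduct_sq_le (u 0) l
    rwa [← hνu, hu0, hll, one_mul] at h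
  have hνabs := abs_le.1 ((sq_le_one_iff_abs_le_one ν).1 hν2)
  have hlast := aligned_gdIter arr harr.2 hinner hf hu hl (w := (s, s • u 0)) hal η k
  rw [hρ] at hη hk hW0small
  have hmain := half_residual_le
    (a := fun j => ((alignedStep m η l)^[j] (s, s • u 0)).1)
    (z := fun j => ((alignedStep m η l)^[j] (s, s • u 0)).2 ⬝ᵥ l)
    (X := fun j => ((alignedStep m η l)^[j] (s, s • u 0)).2 ⬝ᵥ
      ((alignedStep m η l)^[j] (s, s • u 0)).2) (ν := ν)
    (fun j => by
      simp only [Function.iterate_succ_apply']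
      exact scalarStep_alignedStep hll _)
    rfl (by simp [hνu, mul_comm]) (by simp [hu0, sq]) hη0 hs (by norm_num at hW0small ⊢; exact hW0small)
    (lt_of_le_of_ne hνabs.1 hν1.symm) hνabs.2 rfl (lt_min one_pos hε') (min_le_left _ _) hη hk
  refine le_trans ?_ (hmain.trans (min_le_right _ _))
  rw [hf, add_sub_cancel_right, hlast.segProd_eq hu (b := m + 1) (by omega), hl, ← vecMulVec_smul,
    ← vecMulVec_sub, frobNorm_vecMulVec_sq, hun, scalarResidual]
  apply le_of_eq
  simp only [sub_dotProduct, smul_dotProduct, smul_eq_mul, dotProduct_sub,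
    dotProduct_smul, hll, dotProduct_comm l]
  ring
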